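/- Consider the inverse-problem setting with exact coefficient c satisfying c(x) ≥ 0 on Ω and f satisfying condition (7), and the iterative process with sufficiently smooth iterates. Suppose for some k ≥ 1 that c^k(x) ≥ 0 on Ω, that w^k = u^k − u^{k−1} satisfies w^k(x,t) ≥ 0 for all x ∈ Ω, 0 < t ≤ T, and that ξ^k = c^k − c^{k−1} satisfies ξ^k(x) ≤ 0 for all x ∈ Ω. Then ξ^{k+1} = c^{k+1} − c^k satisfies ξ^{k+1}(x) ≤ 0 for all x ∈ Ω, and w^{k+1} = u^{k+1} − u^k satisfies w^{k+1}(x,t) ≥ 0 for all x ∈ Ω, 0 < t ≤ T. -/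

import Mathlib

noncomputable section

/-- The plane `ℝ²`. -/
abbrev E2 : Type := EuclideanSpace ℝ (Fin 2)

/-- The elliptic operator `(A v)(x) = - div (k(x) grad v(x))`. -/
def ellOp (k : E2 → ℝ) (v : E2 → ℝ) (x : E2) : ℝ :=
  - ∑ i : Fin 2, fderiv ℝ (fun y => k y • gradient v y) x (EuclideanSpace.single i 1) i

/-- `u` solves the direct problem on `Ω × (0,T]` with diffusion coefficient `k`,
Robin boundary coefficient `μ`, reaction coefficient `c` and right-hand side `f`:
the parabolic equation, the homogeneous initial condition and the homogeneous
Robin (third-kind) boundary condition with respect to any outward unit normal. -/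
structure IsDirectSolution (Ω : Set E2) (T : ℝ) (k μ : E2 → ℝ)
    (c : E2 → ℝ) (f : E2 → ℝ → ℝ) (u : E2 → ℝ → ℝ) : Prop where
  pde : ∀ x ∈ Ω, ∀ t : ℝ, 0 < t → t ≤ T →
    deriv (u x) t + ellOp k (fun y => u y t) x + c x * u x t = f x t
  ic : ∀ x ∈ Ω, u x 0 = 0
  robin : ∀ x ∈ frontier Ω, ∀ ν : E2, ‖ν‖ = 1 →
    (∀ y ∈ closure Ω, (inner ℝ ν (y - x) : ℝ) ≤ 0) →
    ∀ t : ℝ, 0 < t → t ≤ T →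
      k x * fderiv ℝ (fun y => u y t) x ν + μ x * u x t = 0

open Set Filter Topology MeasureTheory
open scoped ContDiff

/-- unit vectors -/
def ee (i : Fin 2) : E2 := EuclideanSpace.single i 1

/-- partial derivative -/
def pd (i : Fin 2) (v : E2 → ℝ) (x : E2) : ℝ := fderiv ℝ v x (ee i)

/-- divergence -/
def dv (F : E2 → E2) (x : E2) : ℝ := ∑ i : Fin 2, fderiv ℝ F x (ee i) i

lemma ellOp_eq_dv (k v : E2 → ℝ) (x : E2) :
    ellOp k v x = - dv (fun y => k y • gradient v y) x := rfl

lemma gradient_coord (v : E2 → ℝ) (x : E2) (i : Fin 2) : gradient v x i = pd i v x := by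
  have h : inner ℝ (gradient v x) (ee i) = fderiv ℝ v x (ee i) := by
    rw [← toDual_gradient]; simp
  rw [pd, ← h, ee, EuclideanSpace.inner_single_right]
  simp

lemma inner_gradient (v : E2 → ℝ) (x w : E2) : inner ℝ (gradient v x) w = fderiv ℝ v x w := by
  rw [← toDual_gradient]; simp

/-- coordinate map -/
def prj (i : Fin 2) : E2 →L[ℝ] ℝ := EuclideanSpace.proj i

lemma dv_eq (F : E2 → E2) (x : E2) (hF : DifferentiableAt ℝ F x) :
    dv F x = ∑ i : Fin 2, pd i (fun y => F y i) x := by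
  unfold dv pd
  refine Finset.sum_congr rfl fun i _ => ?_
  have h := ((prj i).hasFDerivAt
    (x := F x)).comp x hF.hasFDerivAt
  have h2 : HasFDerivAt (fun y => F y i) ((prj i).comp
    (fderiv ℝ F x)) x := h
  rw [h2.fderiv]; rfl

lemma gradient_eq_toDual (v : E2 → ℝ) :
    gradient v = fun x => (InnerProductSpace.toDual ℝ E2).symm (fderiv ℝ v x) := rfl

lemma contDiff_gradient {v : E2 → ℝ} {n : WithTop ℕ∞} {m : WithTop ℕ∞} (hv : ContDiff ℝ n v)
    (hmn : m + 1 ≤ n) : ContDiff ℝ m (gradient v) := by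
  rw [gradient_eq_toDual]
  exact (InnerProductSpace.toDual ℝ E2).symm.contDiff.comp (hv.fderiv_right hmn)

lemma contDiff_pd {v : E2 → ℝ} {n : WithTop ℕ∞} {m : WithTop ℕ∞} (hv : ContDiff ℝ n v)
    (hmn : m + 1 ≤ n) (i : Fin 2) : ContDiff ℝ m (pd i v) :=
  (hv.fderiv_right hmn).clm_apply contDiff_const

lemma pd_mul {a b : E2 → ℝ} {x : E2} (ha : DifferentiableAt ℝ a x) (hb : DifferentiableAt ℝ b x)
    (i : Fin 2) : pd i (fun y => a y * b y) x = a x * pd i b x + b x * pd i a x := by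
  unfold pd
  rw [fderiv_fun_mul ha hb]; simp

lemma ellOp_eq {k v : E2 → ℝ} {x : E2} (hk : DifferentiableAt ℝ k x) (hv : ContDiff ℝ 2 v) :
    ellOp k v x = - ∑ i : Fin 2, (k x * pd i (pd i v) x + pd i v x * pd i k x) := by
  have hg : ContDiff ℝ 1 (gradient v) := contDiff_gradient hv (by norm_num)
  rw [ellOp_eq_dv, dv_eq _ _ (DifferentiableAt.fun_smul hk (hg.differentiable (by norm_num) x))]
  congr 1
  refine Finset.sum_congr rfl fun i _ => ?_
  have : (fun y => (k y • gradient v y) i) = fun y => k y * pd i v y := by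
    ext y; simp [gradient_coord]
  rw [this, pd_mul hk ((contDiff_pd hv (m := 1) (by norm_num) i).differentiable (by norm_num) x)]

lemma two_le : (2 : WithTop ℕ∞) ≤ ∞ := WithTop.coe_le_coe.2 (le_top : (2 : ℕ∞) ≤ ⊤)

/-- joint smoothness -/
def Sm (z : E2 → ℝ → ℝ) : Prop := ContDiff ℝ ∞ (Function.uncurry z)

/-- time derivative -/
def Dt (z : E2 → ℝ → ℝ) : E2 → ℝ → ℝ := fun x t => deriv (z x) t

/-- space derivative -/
def Dx (i : Fin 2) (z : E2 → ℝ → ℝ) : E2 → ℝ → ℝ := fun x t => pd i (fun y => z y t) x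

lemma Sm.slice_x {z} (hz : Sm z) (t : ℝ) : ContDiff ℝ ∞ (fun y => z y t) :=
  hz.comp (contDiff_id.prodMk contDiff_const)

lemma Sm.slice_t {z} (hz : Sm z) (x : E2) : ContDiff ℝ ∞ (z x) :=
  hz.comp (contDiff_const.prodMk contDiff_id)

lemma Sm.sub {z w} (hz : Sm z) (hw : Sm w) : Sm (fun x t => z x t - w x t) :=
  ContDiff.sub hz hw

lemma Sm.neg {z} (hz : Sm z) : Sm (fun x t => - z x t) :=
  ContDiff.neg hz

lemma Sm.hasFDeriv {z} (hz : Sm z) (p : E2 × ℝ) :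
    HasFDerivAt (Function.uncurry z) (fderiv ℝ (Function.uncurry z) p) p :=
  (hz.differentiable (by simp) p).hasFDerivAt

lemma Sm.Dt_eq {z} (hz : Sm z) (x : E2) (t : ℝ) :
    Dt z x t = fderiv ℝ (Function.uncurry z) (x, t) (0, 1) := by
  have h := (hz.hasFDeriv (x, t)).comp_hasDerivAt t
    ((hasDerivAt_const t x).prodMk (hasDerivAt_id t))
  exact h.deriv

lemma Sm.fderiv_slice {z} (hz : Sm z) (x : E2) (t : ℝ) (w : E2) :
    fderiv ℝ (fun y => z y t) x w = fderiv ℝ (Function.uncurry z) (x, t) (w, 0) := by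
  have h1 : HasFDerivAt (fun y : E2 => (y, t)) ((ContinuousLinearMap.id ℝ E2).prod 0) x :=
    (hasFDerivAt_id x).prodMk (hasFDerivAt_const t x)
  have h := HasFDerivAt.comp x (hz.hasFDeriv (x, t)) h1
  have h2 : HasFDerivAt (fun y => z y t) ((fderiv ℝ (Function.uncurry z) (x, t)).comp
    ((ContinuousLinearMap.id ℝ E2).prod 0)) x := h
  rw [h2.fderiv]; simp

lemma Sm.fd {z} (hz : Sm z) (w : E2 × ℝ) :
    ContDiff ℝ ∞ (fun p => fderiv ℝ (Function.uncurry z) p w) :=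
  (hz.fderiv_right (m := ∞) (by simp)).clm_apply contDiff_const

lemma Sm.Dt {z} (hz : Sm z) : Sm (Dt z) := by
  have : Function.uncurry (_root_.Dt z) = fun p => fderiv ℝ (Function.uncurry z) p (0, 1) := by
    ext ⟨x, t⟩; exact hz.Dt_eq x t
  unfold Sm; rw [this]; exact hz.fd _

/-- directional derivative -/
def Dw (w : E2) (z : E2 → ℝ → ℝ) : E2 → ℝ → ℝ := fun x t => fderiv ℝ (fun y => z y t) x w

lemma Sm.Dw {z} (hz : Sm z) (w : E2) : Sm (Dw w z) := by
  have : Function.uncurry (_root_.Dw w z) = fun p => fderiv ℝ (Function.uncurry z) p (w, 0) := by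
    ext ⟨x, t⟩; exact hz.fderiv_slice x t _
  unfold Sm; rw [this]; exact hz.fd _

lemma Sm.Dx {z} (hz : Sm z) (i : Fin 2) : Sm (Dx i z) := hz.Dw (ee i)

lemma Sm.Dt_Dw {z} (hz : Sm z) (w : E2) : _root_.Dt (_root_.Dw w z) = _root_.Dw w (_root_.Dt z) := by
  ext x t
  rw [(hz.Dw w).Dt_eq]
  have e2 : _root_.Dw w (_root_.Dt z) x t =
    fderiv ℝ (Function.uncurry (_root_.Dt z)) (x, t) (w, 0) := hz.Dt.fderiv_slice x t w
  rw [e2]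
  have h1 : Function.uncurry (_root_.Dt z) = fun p => fderiv ℝ (Function.uncurry z) p (0, 1) := by
    ext ⟨x, t⟩; exact hz.Dt_eq x t
  have h2 : Function.uncurry (_root_.Dw w z) = fun p => fderiv ℝ (Function.uncurry z) p (w, 0) := by
    ext ⟨x, t⟩; exact hz.fderiv_slice x t _
  rw [h1, h2]
  have hd : DifferentiableAt ℝ (fderiv ℝ (Function.uncurry z)) (x, t) :=
    (hz.fderiv_right (m := ∞) (by simp)).differentiable (by simp) _
  have hs : IsSymmSndFDerivAt ℝ (Function.uncurry z) (x, t) :=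
    (ContDiff.contDiffAt hz).isSymmSndFDerivAt (by simp; exact two_le)
  rw [fderiv_clm_apply hd (by fun_prop), fderiv_clm_apply hd (by fun_prop)]
  simp
  exact hs.eq _ _

lemma Sm.hasDerivAt {z} (hz : Sm z) (x : E2) (t : ℝ) : HasDerivAt (z x) (_root_.Dt z x t) t :=
  ((hz.slice_t x).differentiable (by simp) t).hasDerivAt

lemma ellOp_slice {k : E2 → ℝ} {x : E2} (hk : DifferentiableAt ℝ k x) {z} (hz : Sm z) (t : ℝ) :
    ellOp k (fun y => z y t) x =
      - ∑ i : Fin 2, (k x * Dx i (Dx i z) x t + Dx i z x t * pd i k x) := by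
  rw [ellOp_eq hk ((hz.slice_x t).of_le two_le)]
  rfl

lemma ellOp_hasDerivAt {k : E2 → ℝ} {x : E2} (hk : DifferentiableAt ℝ k x) {z} (hz : Sm z) (t : ℝ) :
    HasDerivAt (fun s => ellOp k (fun y => z y s) x) (ellOp k (fun y => Dt z y t) x) t := by
  simp_rw [ellOp_slice hk hz]
  rw [ellOp_slice hk hz.Dt]
  have e1 : ∀ i, Dx i (Dt z) = Dt (Dx i z) := fun i => (hz.Dt_Dw (ee i)).symm
  have e2 : ∀ i, Dx i (Dx i (Dt z)) = Dt (Dx i (Dx i z)) := fun i => by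
    rw [e1]; exact ((hz.Dx i).Dt_Dw (ee i)).symm
  simp_rw [e2, e1]
  refine HasDerivAt.neg ?_
  refine HasDerivAt.fun_sum fun i _ => ?_
  exact ((((hz.Dx i).Dx i).hasDerivAt x t).const_mul _).add (((hz.Dx i).hasDerivAt x t).mul_const _)

/-- bundle of the standing assumptions -/
structure Dom (Ω : Set E2) (T : ℝ) (k μ : E2 → ℝ) (k₁ k₂ : ℝ) : Prop where
  op : IsOpen Ω
  bd : Bornology.IsBounded Ω
  cv : Convex ℝ Ω
  ne : Ω.Nonempty
  hT : 0 < T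
  hk₁ : 0 < k₁
  hkbd : ∀ x ∈ closure Ω, k₁ ≤ k x ∧ k x ≤ k₂
  hkC1 : ContDiffOn ℝ 1 k (closure Ω)
  hμ : ∀ x ∈ frontier Ω, 0 ≤ μ x

lemma uniqueDiff_closure {Ω : Set E2} (op : IsOpen Ω) (cv : Convex ℝ Ω) (ne : Ω.Nonempty) :
    UniqueDiffOn ℝ (closure Ω) :=
  uniqueDiffOn_convex cv.closure (ne.mono (interior_maximal subset_closure op))

lemma C1_facts {G : Type*} [NormedAddCommGroup G] [NormedSpace ℝ G] {Ω : Set E2}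
    (op : IsOpen Ω) (bd : Bornology.IsBounded Ω) (cv : Convex ℝ Ω) {F : E2 → G}
    (hF : ContDiffOn ℝ 1 F (closure Ω)) :
    (∀ x ∈ Ω, DifferentiableAt ℝ F x) ∧ ContinuousOn (fderiv ℝ F) Ω ∧
      ∃ C : ℝ, 0 ≤ C ∧ ∀ x ∈ Ω, ‖fderiv ℝ F x‖ ≤ C := by
  rcases Ω.eq_empty_or_nonempty with rfl | ne
  · simp; exact ⟨0, le_rfl⟩
  have hn : ∀ x ∈ Ω, closure Ω ∈ 𝓝 x := fun x hx =>
    mem_of_superset (op.mem_nhds hx) subset_closure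
  have hc := hF.continuousOn_fderivWithin (uniqueDiff_closure op cv ne) le_rfl
  have he : ∀ x ∈ Ω, fderivWithin ℝ F (closure Ω) x = fderiv ℝ F x := fun x hx =>
    fderivWithin_of_mem_nhds (hn x hx)
  refine ⟨fun x hx => (hF.differentiableOn (by norm_num) x (subset_closure hx)).differentiableAt
    (hn x hx), (hc.mono subset_closure).congr fun x hx => (he x hx).symm, ?_⟩
  have hK : IsCompact (closure Ω) := bd.isCompact_closure
  obtain ⟨C, hC⟩ := hK.exists_bound_of_continuousOn hc
  refine ⟨max C 0, le_max_right _ _, fun x hx => ?_⟩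
  rw [← he x hx]
  exact (hC x (subset_closure hx)).trans (le_max_left _ _)

lemma norm_ee (i : Fin 2) : ‖ee i‖ = 1 := by simp [ee]

lemma abs_pd_le (v : E2 → ℝ) (x : E2) (i : Fin 2) : |pd i v x| ≤ ‖fderiv ℝ v x‖ := by
  have := (fderiv ℝ v x).le_opNorm (ee i)
  rwa [norm_ee, mul_one, Real.norm_eq_abs] at this

lemma Dom.diff {Ω T k μ k₁ k₂} (D : Dom Ω T k μ k₁ k₂) {x : E2} (hx : x ∈ Ω) :
    DifferentiableAt ℝ k x := (C1_facts D.op D.bd D.cv D.hkC1).1 x hx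

lemma Dom.exK {Ω T k μ k₁ k₂} (D : Dom Ω T k μ k₁ k₂) :
    ∃ K : ℝ, 0 ≤ K ∧ ∀ x ∈ Ω, ∀ i, |pd i k x| ≤ K := by
  obtain ⟨C, h0, hC⟩ := (C1_facts D.op D.bd D.cv D.hkC1).2.2
  exact ⟨C, h0, fun x hx i => (abs_pd_le k x i).trans (hC x hx)⟩

/-- outward unit normal -/
def Nrm (Ω : Set E2) (x ν : E2) : Prop :=
  ‖ν‖ = 1 ∧ ∀ y ∈ closure Ω, (inner ℝ ν (y - x) : ℝ) ≤ 0

lemma exists_nrm {Ω : Set E2} (op : IsOpen Ω) (cv : Convex ℝ Ω) (ne : Ω.Nonempty) {x : E2}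
    (hx : x ∈ frontier Ω) : ∃ ν, Nrm Ω x ν := by
  have hx' : x ∉ Ω := by rw [op.frontier_eq] at hx; exact hx.2
  obtain ⟨f, hf⟩ := geometric_hahn_banach_open_point cv op hx'
  obtain ⟨a, ha⟩ := ne
  set w := (InnerProductSpace.toDual ℝ E2).symm f with hw
  have hfw : ∀ y, inner ℝ w y = f y := fun y => by
    rw [hw]; exact InnerProductSpace.toDual_symm_apply
  have hw0 : w ≠ 0 := by
    intro h
    have h1 := hf a ha
    rw [← hfw, ← hfw, h] at h1; simp at h1
  refine ⟨‖w‖⁻¹ • w, norm_smul_inv_norm hw0, fun y hy => ?_⟩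
  rw [real_inner_smul_left]
  refine mul_nonpos_of_nonneg_of_nonpos (by positivity) ?_
  refine closure_minimal (s := Ω) (t := {y | inner ℝ w (y - x) ≤ 0}) (fun y hy => ?_)
    (isClosed_le (by fun_prop) (by fun_prop)) hy
  have := hf y hy
  rw [← hfw, ← hfw] at this
  simp only [mem_ofPred_eq, inner_sub_right]; linarith

lemma nrm_pos {Ω : Set E2} (op : IsOpen Ω) {x ν b : E2} (hν : Nrm Ω x ν) (hb : b ∈ Ω) :
    0 < inner ℝ ν (x - b) := by
  obtain ⟨r, hr, hB⟩ := Metric.isOpen_iff.1 op b hb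
  have hy : b + (r / 2) • ν ∈ Ω := hB (by
    simp [norm_smul, hν.1, abs_of_pos hr]; linarith)
  have := hν.2 _ (subset_closure hy)
  have e : b + (r / 2) • ν - x = (r/2) • ν - (x - b) := by abel
  rw [e, inner_sub_right, real_inner_smul_right, real_inner_self_eq_norm_sq, hν.1] at this
  nlinarith

lemma deriv2_nonneg {g : ℝ → ℝ} (hg : ContDiff ℝ 2 g) {x : ℝ} (hm : IsLocalMin g x) :
    0 ≤ deriv (deriv g) x := by
  by_contra! h
  have hM := isLocalMax_of_deriv_deriv_neg h hm.deriv_eq_zero hg.continuous.continuousAt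
  have he : g =ᶠ[𝓝 x] fun _ => g x := by
    filter_upwards [hm, hM] with y h1 h2 using le_antisymm h2 h1
  have h2 := he.deriv.deriv_eq
  simp at h2
  linarith

lemma line_deriv {v : E2 → ℝ} (hv : Differentiable ℝ v) (x w : E2) (s : ℝ) :
    HasDerivAt (fun s : ℝ => v (x + s • w)) (fderiv ℝ v (x + s • w) w) s := by
  have h1 : HasDerivAt (fun s : ℝ => x + s • w) w s := by
    simpa using ((hasDerivAt_id s).smul_const w).const_add x
  exact (hv (x + s • w)).hasFDerivAt.comp_hasDerivAt s h1

lemma pd2_nonneg {v : E2 → ℝ} (hv : ContDiff ℝ 2 v) {x : E2} (hm : IsLocalMin v x) (i : Fin 2) :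
    0 ≤ pd i (pd i v) x := by
  have hg : ContDiff ℝ 2 (fun s : ℝ => v (x + s • ee i)) := by fun_prop
  have hm' : IsLocalMin (fun s : ℝ => v (x + s • ee i)) 0 := by
    have hc : ContinuousAt (fun s : ℝ => x + s • ee i) 0 := by fun_prop
    have : IsLocalMin v (x + (0:ℝ) • ee i) := by simpa using hm
    exact hc.eventually this
  have h := deriv2_nonneg hg hm'
  have e1 : deriv (fun s : ℝ => v (x + s • ee i)) = fun s => pd i v (x + s • ee i) := by
    ext s; exact (line_deriv (hv.differentiable (by norm_num)) x (ee i) s).deriv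
  rw [e1, (line_deriv ((contDiff_pd hv (m := 1) (by norm_num) i).differentiable (by norm_num))
    x (ee i) 0).deriv] at h
  simpa [pd] using h

lemma ellOp_nonpos {k v : E2 → ℝ} {x : E2} (hk : DifferentiableAt ℝ k x) (hk0 : 0 ≤ k x)
    (hv : ContDiff ℝ 2 v) (hm : IsLocalMin v x) : ellOp k v x ≤ 0 := by
  rw [ellOp_eq hk hv]
  have h0 : ∀ i, pd i v x = 0 := fun i => by rw [pd, hm.fderiv_eq_zero]; rfl
  rw [neg_nonpos]
  refine Finset.sum_nonneg fun i _ => ?_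
  rw [h0]
  have := pd2_nonneg hv hm i
  nlinarith [mul_nonneg hk0 this]

lemma pd_add {a b : E2 → ℝ} {x : E2} (ha : DifferentiableAt ℝ a x) (hb : DifferentiableAt ℝ b x)
    (i : Fin 2) : pd i (fun y => a y + b y) x = pd i a x + pd i b x := by
  unfold pd; rw [fderiv_fun_add ha hb]; simp

lemma pd_const_mul {b : E2 → ℝ} {x : E2} (r : ℝ) (hb : DifferentiableAt ℝ b x)
    (i : Fin 2) : pd i (fun y => r * b y) x = r * pd i b x := by
  unfold pd; rw [fderiv_const_mul hb]; simp

lemma ellOp_add_mul {k v w : E2 → ℝ} {x : E2} (hk : DifferentiableAt ℝ k x)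
    (hv : ContDiff ℝ 2 v) (hw : ContDiff ℝ 2 w) (r : ℝ) :
    ellOp k (fun y => v y + r * w y) x = ellOp k v x + r * ellOp k w x := by
  rw [ellOp_eq hk hv, ellOp_eq hk hw, ellOp_eq hk (hv.add (contDiff_const.mul hw))]
  have dv := hv.differentiable (by norm_num)
  have dw := hw.differentiable (by norm_num)
  have e1 : ∀ i, pd i (fun y => v y + r * w y) = fun y => pd i v y + r * pd i w y := fun i => by
    ext y; rw [pd_add (dv y) ((dw y).const_mul r), pd_const_mul r (dw y)]
  have e2 : ∀ i, pd i (pd i (fun y => v y + r * w y)) x = pd i (pd i v) x + r * pd i (pd i w) x := by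
    intro i
    have d1 := (contDiff_pd hv (m := 1) (by norm_num) i).differentiable (by norm_num)
    have d2 := (contDiff_pd hw (m := 1) (by norm_num) i).differentiable (by norm_num)
    rw [e1, pd_add (d1 x) ((d2 x).const_mul r), pd_const_mul r (d2 x)]
  simp only [Fin.sum_univ_two, e2]
  simp only [e1]
  ring

lemma deriv_nonpos_of_left_min {f : ℝ → ℝ} {f' t : ℝ} (ht : 0 < t) (hf : HasDerivAt f f' t)
    (hm : ∀ s, 0 ≤ s → s ≤ t → f t ≤ f s) : f' ≤ 0 := by
  have h := hf.tendsto_slope.mono_left (nhdsWithin_mono t (fun s (hs : s ∈ Iio t) => ne_of_lt hs))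
  refine le_of_tendsto h ?_
  have : Ioo 0 t ∈ 𝓝[<] t := Ioo_mem_nhdsLT ht
  filter_upwards [this] with s hs
  rw [slope_def_field]
  exact div_nonpos_of_nonneg_of_nonpos (sub_nonneg.2 (hm s hs.1.le hs.2.le)) (by linarith [hs.2])

lemma boundary_min {Ω : Set E2} (op : IsOpen Ω) (cv : Convex ℝ Ω) (ne : Ω.Nonempty) {x : E2}
    (hx : x ∈ frontier Ω) {v : E2 → ℝ} (hv : Differentiable ℝ v)
    (hm : ∀ y ∈ closure Ω, v x ≤ v y) : ∃ ν, Nrm Ω x ν ∧ fderiv ℝ v x ν ≤ 0 := by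
  by_cases hG : gradient v x = 0
  · obtain ⟨ν, hν⟩ := exists_nrm op cv ne hx
    refine ⟨ν, hν, ?_⟩
    rw [← inner_gradient, hG]; simp
  · refine ⟨-(‖gradient v x‖⁻¹ • gradient v x), ⟨?_, fun y hy => ?_⟩, ?_⟩
    · rw [norm_neg]; exact norm_smul_inv_norm hG
    · rw [inner_neg_left, real_inner_smul_left, neg_nonpos]
      refine mul_nonneg (by positivity) ?_
      rw [inner_gradient]
      have hd := line_deriv hv x (y - x) 0
      simp only [zero_smul, add_zero] at hd
      have h := hd.tendsto_slope.mono_left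
        (nhdsWithin_mono 0 (fun s (hs : s ∈ Ioi (0:ℝ)) => ne_of_gt hs))
      refine ge_of_tendsto h ?_
      filter_upwards [Ioo_mem_nhdsGT (show (0:ℝ) < 1 by norm_num)] with s hs
      rw [slope_def_field]
      have hmem : x + s • (y - x) ∈ closure Ω :=
        cv.closure.add_smul_sub_mem (frontier_subset_closure hx) hy ⟨hs.1.le, hs.2.le⟩
      have := hm _ hmem
      refine div_nonneg (by simpa using this) (by linarith [hs.1])
    · rw [← inner_gradient, inner_neg_right, real_inner_smul_right]
      rw [neg_nonpos]
      exact mul_nonneg (by positivity) real_inner_self_nonneg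

/-- squared distance -/
def sqd (b x : E2) : ℝ := ‖x - b‖ ^ 2

lemma sqd_contDiff (b : E2) {n : WithTop ℕ∞} : ContDiff ℝ n (sqd b) :=
  (contDiff_id.sub contDiff_const).norm_sq ℝ

lemma sqd_fderiv (b x w : E2) : fderiv ℝ (sqd b) x w = 2 * inner ℝ (x - b) w := by
  have h : HasFDerivAt (fun y : E2 => y - b) (ContinuousLinearMap.id ℝ E2) x :=
    (hasFDerivAt_id x).sub_const b
  have := h.norm_sq
  rw [show sqd b = fun y => ‖y - b‖ ^ 2 from rfl, this.fderiv]
  simp [inner_sub_left]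

lemma sqd_pd (b x : E2) (i : Fin 2) : pd i (sqd b) x = 2 * (x i - b i) := by
  rw [pd, sqd_fderiv, ee, EuclideanSpace.inner_single_right]; simp

lemma coord_fderiv (r s : ℝ) (i : Fin 2) (x : E2) : pd i (fun y => r * (y i - s)) x = r := by
  have h : HasFDerivAt (fun y : E2 => r * (y i - s)) (r • prj i) x := by
    have := ((prj i).hasFDerivAt (x := x)).sub_const s
    exact this.const_mul r
  rw [pd, h.fderiv]; simp [prj, ee]

lemma sqd_pd2 (b x : E2) (i : Fin 2) : pd i (pd i (sqd b)) x = 2 := by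
  have : pd i (sqd b) = fun x => 2 * (x i - b i) := by ext x; exact sqd_pd b x i
  rw [this, coord_fderiv]

lemma coord_le (x b : E2) (i : Fin 2) : |x i - b i| ≤ ‖x - b‖ := by
  have := PiLp.norm_apply_le (x - b) i
  simpa using this

lemma Dom.exR {Ω T k μ k₁ k₂} (D : Dom Ω T k μ k₁ k₂) (b : E2) :
    ∃ R : ℝ, 0 ≤ R ∧ ∀ x ∈ Ω, ‖x - b‖ ≤ R := by
  obtain ⟨R, hR⟩ := D.bd.subset_closedBall b
  refine ⟨max R 0, le_max_right _ _, fun x hx => ?_⟩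
  have := hR hx
  rw [Metric.mem_closedBall, dist_eq_norm] at this
  exact this.trans (le_max_left _ _)

lemma Dom.sqd_bound {Ω T k μ k₁ k₂} (D : Dom Ω T k μ k₁ k₂) (b : E2) :
    ∃ C : ℝ, 0 ≤ C ∧ ∀ x ∈ Ω, - C ≤ ellOp k (sqd b) x := by
  obtain ⟨K, hK0, hK⟩ := D.exK
  obtain ⟨R, hR0, hR⟩ := D.exR b
  have hk2 : 0 ≤ k₂ := by
    obtain ⟨x, hx⟩ := D.ne
    have := D.hkbd x (subset_closure hx); linarith [D.hk₁]
  refine ⟨4 * k₂ + 4 * R * K, by positivity, fun x hx => ?_⟩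
  rw [ellOp_eq (D.diff hx) (sqd_contDiff b)]
  simp only [sqd_pd2, sqd_pd, Fin.sum_univ_two]
  have hkx := (D.hkbd x (subset_closure hx)).2
  have key : ∀ i, (x i - b i) * pd i k x ≤ R * K := fun i => by
    refine (le_abs_self _).trans ?_
    rw [abs_mul]
    exact mul_le_mul ((coord_le x b i).trans (hR x hx)) (hK x hx i) (abs_nonneg _) hR0
  nlinarith [key 0, key 1]

lemma Sm.cont {z} (hz : Sm z) : Continuous (Function.uncurry z) := ContDiff.continuous hz

lemma ic_closure {Ω : Set E2} {z : E2 → ℝ → ℝ} (hz : Sm z) (h : ∀ x ∈ Ω, z x 0 = 0) :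
    ∀ x ∈ closure Ω, z x 0 = 0 := fun x hx =>
  closure_minimal (s := Ω) (t := {y | z y 0 = 0}) h
    (isClosed_eq (hz.slice_x 0).continuous continuous_const) hx

theorem MP {Ω T k μ k₁ k₂} (D : Dom Ω T k μ k₁ k₂) {q : E2 → ℝ} {g z : E2 → ℝ → ℝ}
    (hq : ∀ x ∈ Ω, 0 ≤ q x) (hz : Sm z) (hs : IsDirectSolution Ω T k μ q g z)
    (hg : ∀ x ∈ Ω, ∀ t, 0 < t → t ≤ T → 0 ≤ g x t) :
    ∀ x ∈ Ω, ∀ t, 0 ≤ t → t ≤ T → 0 ≤ z x t := by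
  intro x0 hx0 t0 ht0 htT
  by_contra! hneg
  obtain ⟨b, hb⟩ := D.ne
  obtain ⟨C, hC0, hC⟩ := D.sqd_bound b
  set P : E2 → ℝ → ℝ := fun x t => sqd b x + (C + 1) * t + 1 with hP
  have hP0 : ∀ x t, 0 ≤ t → 0 < P x t := fun x t ht => by
    have : 0 ≤ sqd b x := by unfold sqd; positivity
    simp only [hP]; nlinarith [mul_nonneg (by linarith : 0 ≤ C + 1) ht]
  obtain ⟨ε, hε, hεn⟩ : ∃ ε > 0, z x0 t0 + ε * P x0 t0 < 0 := by
    have h1 := hP0 x0 t0 ht0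
    refine ⟨- z x0 t0 / (2 * P x0 t0), by apply div_pos <;> linarith, ?_⟩
    field_simp; linarith
  set Y : E2 → ℝ → ℝ := fun x t => z x t + ε * P x t with hY
  have hPc : Continuous (Function.uncurry P) := by
    simp only [hP, sqd]; unfold Function.uncurry; fun_prop
  have hYc : Continuous (Function.uncurry Y) := by
    have : Function.uncurry Y = fun p => Function.uncurry z p + ε * Function.uncurry P p := by
      ext ⟨x, t⟩; rfl
    rw [this]; exact hz.cont.add (continuous_const.mul hPc)
  have hKc : IsCompact (closure Ω ×ˢ Icc 0 T) := D.bd.isCompact_closure.prod isCompact_Icc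
  obtain ⟨⟨x1, t1⟩, ⟨hx1, ht1⟩, hmin⟩ := hKc.exists_isMinOn
    ⟨(x0, t0), subset_closure hx0, ht0, htT⟩ hYc.continuousOn
  simp only at hx1 ht1
  have hmin' : ∀ x ∈ closure Ω, ∀ t, 0 ≤ t → t ≤ T → Y x1 t1 ≤ Y x t := fun x hx t h0 h1 =>
    hmin (show (x, t) ∈ closure Ω ×ˢ Icc 0 T from ⟨hx, h0, h1⟩)
  have hY1 : Y x1 t1 < 0 := (hmin' x0 (subset_closure hx0) t0 ht0 htT).trans_lt hεn
  have ht1p : 0 < t1 := by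
    rcases ht1.1.eq_or_lt with h | h
    · exfalso
      rw [← h] at hY1
      have h2 := ic_closure hz hs.ic x1 hx1
      simp only [hY, h2] at hY1
      have := mul_pos hε (hP0 x1 0 le_rfl)
      linarith
    · exact h
  have hzneg : z x1 t1 < 0 := by
    have := mul_pos hε (hP0 x1 t1 ht1.1)
    simp only [hY] at hY1; linarith
  have hPx : ContDiff ℝ 2 (fun y => P y t1) := by
    simp only [hP]; exact ((sqd_contDiff b).add contDiff_const).add contDiff_const
  have hzx : ContDiff ℝ 2 (fun y => z y t1) := (hz.slice_x t1).of_le two_le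
  have hYx : ContDiff ℝ 2 (fun y => Y y t1) := hzx.add (contDiff_const.mul hPx)
  have hk1 : 0 < k x1 := D.hk₁.trans_le (D.hkbd x1 hx1).1
  by_cases hin : x1 ∈ Ω
  · have hlm : IsLocalMin (fun y => Y y t1) x1 := by
      filter_upwards [D.op.mem_nhds hin] with y hy using hmin' y (subset_closure hy) t1 ht1.1 ht1.2
    have hA := ellOp_nonpos (D.diff hin) hk1.le hYx hlm
    simp only [hY] at hA
    rw [ellOp_add_mul (D.diff hin) hzx hPx] at hA
    have hAP : ellOp k (fun y => P y t1) x1 = ellOp k (sqd b) x1 := by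
      have h1 := ellOp_add_mul (D.diff hin) (sqd_contDiff b)
        (contDiff_const (c := (C + 1) * t1 + 1)) 1 (k := k)
      have h2 : ellOp k (fun _ : E2 => (C + 1) * t1 + 1) x1 = 0 := by
        rw [ellOp_eq (D.diff hin) contDiff_const]
        have : ∀ i, pd i (fun _ : E2 => (C + 1) * t1 + 1) = fun _ => 0 := fun i => by
          ext y; simp [pd]
        simp only [this]
        simp [pd]
      rw [h2, mul_zero, add_zero] at h1
      rw [← h1]; congr 1; ext y; simp only [hP]; ring
    rw [hAP] at hA
    have hdY : HasDerivAt (Y x1) (Dt z x1 t1 + ε * (C + 1)) t1 := by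
      have h1 : HasDerivAt (P x1) (C + 1) t1 := by
        have h := (((hasDerivAt_id t1).const_mul (C + 1)).const_add (sqd b x1)).add_const 1
        rw [mul_one] at h
        exact h
      exact (hz.hasDerivAt x1 t1).add (h1.const_mul ε)
    have hd := deriv_nonpos_of_left_min ht1p hdY
      fun s h0 h1 => hmin' x1 hx1 s h0 (h1.trans ht1.2)
    have hpde := hs.pde x1 hin t1 ht1p ht1.2
    have hg1 := hg x1 hin t1 ht1p ht1.2
    have hq1 : q x1 * z x1 t1 ≤ 0 := mul_nonpos_of_nonneg_of_nonpos (hq x1 hin) hzneg.le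
    change Dt z x1 t1 + _ + _ = _ at hpde
    nlinarith [hC x1 hin, mul_le_mul_of_nonneg_left (hC x1 hin) hε.le]
  · have hfr : x1 ∈ frontier Ω := by rw [D.op.frontier_eq]; exact ⟨hx1, hin⟩
    obtain ⟨ν, hν, hle⟩ := boundary_min D.op D.cv ⟨b, hb⟩ hfr (hYx.differentiable (by norm_num))
      fun y hy => hmin' y hy t1 ht1.1 ht1.2
    have hrob := hs.robin x1 hfr ν hν.1 hν.2 t1 ht1p ht1.2
    have e : fderiv ℝ (fun y => Y y t1) x1 ν =
        fderiv ℝ (fun y => z y t1) x1 ν + ε * (2 * inner ℝ (x1 - b) ν) := by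
      have e0 : fderiv ℝ (fun y => P y t1) x1 = fderiv ℝ (sqd b) x1 := by
        simp only [hP]; simp
      simp only [hY]
      rw [fderiv_fun_add (hzx.differentiable (by norm_num) _)
        ((hPx.differentiable (by norm_num) _).const_mul ε),
        fderiv_const_mul (hPx.differentiable (by norm_num) _), e0]
      simp [sqd_fderiv]
    have hp := nrm_pos D.op hν hb
    rw [real_inner_comm] at hp
    rw [e] at hle
    have hm := mul_nonpos_of_nonneg_of_nonpos (D.hμ x1 hfr) hzneg.le
    have h1 : fderiv ℝ (fun y => z y t1) x1 ν < 0 := by nlinarith [mul_pos hε hp]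
    nlinarith [mul_neg_of_pos_of_neg hk1 h1]

lemma flow_contain {Ω : Set E2} (op : IsOpen Ω) (bd : Bornology.IsBounded Ω) (cv : Convex ℝ Ω)
    {b : E2} (hb : b ∈ Ω) {F : E2 → E2} (hF : ContinuousOn F (closure Ω))
    (hN : ∀ x ∈ frontier Ω, ∀ ν, Nrm Ω x ν → inner ℝ ν (F x) ≤ (0 : ℝ)) {δ : ℝ} (hδ : 0 < δ) :
    ∃ ε0 > 0, ∀ ε, 0 < ε → ε < ε0 → ∀ x ∈ Ω,
      x + ε • F x ∈ AffineMap.homothety b (1 + δ * ε) '' closure Ω := by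
  have hcl : IsCompact (closure Ω) := bd.isCompact_closure
  obtain ⟨r, hr, hrn⟩ : ∃ r > 0, ∀ x' ν, Nrm Ω x' ν → r ≤ inner ℝ ν (x' - b) := by
    obtain ⟨r, hr, hB⟩ := Metric.isOpen_iff.1 op b hb
    refine ⟨r / 2, by positivity, fun x' ν hν => ?_⟩
    have hy : b + (r / 2) • ν ∈ Ω := hB (by
      simp [norm_smul, hν.1, abs_of_pos hr]; linarith)
    have := hν.2 _ (subset_closure hy)
    have e : b + (r / 2) • ν - x' = (r/2) • ν - (x' - b) := by abel
    rw [e, inner_sub_right, real_inner_smul_right, real_inner_self_eq_norm_sq, hν.1] at this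
    nlinarith
  obtain ⟨M, hM⟩ := hcl.exists_bound_of_continuousOn hF
  have hM0 : 0 ≤ M := (norm_nonneg _).trans (hM b (subset_closure hb))
  let S : Set (E2 × E2 × E2) := closure Ω ×ˢ closure Ω ×ˢ Metric.sphere 0 1
  have hS : IsCompact S := hcl.prod (hcl.prod (isCompact_sphere _ _))
  let K1 : Set (E2 × E2 × E2) := S ∩ (fun p => inner ℝ p.2.2 (F p.1)) ⁻¹' (Ici (δ * r))
  have hK1 : IsClosed K1 := by
    refine ContinuousOn.preimage_isClosed_of_isClosed ?_ hS.isClosed isClosed_Ici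
    have h1 : ContinuousOn (fun p : E2 × E2 × E2 => F p.1) S :=
      hF.comp (continuous_fst.continuousOn) fun p hp => hp.1
    have h2 : ContinuousOn (fun p : E2 × E2 × E2 => p.2.2) S := by fun_prop
    exact h2.inner h1
  let K2 : Set (E2 × E2 × E2) := ⋂ y ∈ closure Ω, {p | inner ℝ p.2.2 (y - p.2.1) ≤ (0:ℝ)}
  have hK2 : IsClosed K2 := isClosed_biInter fun y _ => isClosed_le (by fun_prop) (by fun_prop)
  have hKK : IsCompact (K1 ∩ K2) :=
    hS.of_isClosed_subset (hK1.inter hK2) fun p hp => hp.1.1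
  have hpos : ∀ p ∈ K1 ∩ K2, (0:ℝ) < inner ℝ p.2.2 (p.2.1 - p.1) := by
    rintro ⟨x, x', ν⟩ ⟨⟨⟨hx, hx', hν⟩, h1⟩, h2⟩
    simp only [mem_preimage, mem_Ici] at h1
    simp only [K2, mem_iInter₂, mem_ofPred_eq] at h2
    simp only at hx hx' hν ⊢
    have hν1 : ‖ν‖ = 1 := by simpa using hν
    by_contra! hle
    have hnx : Nrm Ω x ν := ⟨hν1, fun y hy => by
      have := h2 y hy
      rw [show y - x = (y - x') + (x' - x) by abel, inner_add_right]; linarith⟩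
    have hfr : x ∈ frontier Ω := by
      rw [op.frontier_eq]
      refine ⟨hx, fun hin => ?_⟩
      have := nrm_pos op hnx hin
      simp at this
    have := hN x hfr ν hnx
    have := mul_pos hδ hr
    linarith
  obtain ⟨m, hm, hmin⟩ : ∃ m > 0, ∀ p ∈ K1 ∩ K2, m ≤ inner ℝ p.2.2 (p.2.1 - p.1) := by
    rcases (K1 ∩ K2).eq_empty_or_nonempty with h | h
    · exact ⟨1, one_pos, by simp [h]⟩
    · obtain ⟨p, hp, hpm⟩ := hKK.exists_isMinOn h
        (f := fun p : E2 × E2 × E2 => (inner ℝ p.2.2 (p.2.1 - p.1) : ℝ)) (by fun_prop)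
      exact ⟨_, hpos p hp, fun p' hp' => hpm hp'⟩
  refine ⟨m / (M + 1), by positivity, fun ε hε hεm x hx => ?_⟩
  have ha : 0 < 1 + δ * ε := by positivity
  set y' : E2 := b + (1 + δ * ε)⁻¹ • (x + ε • F x - b) with hy'
  have hyeq : AffineMap.homothety b (1 + δ * ε) y' = x + ε • F x := by
    rw [AffineMap.homothety_apply, hy']
    simp only [vsub_eq_sub, vadd_eq_add, add_sub_cancel_left]
    rw [smul_inv_smul₀ ha.ne']; abel
  refine ⟨y', ?_, hyeq⟩
  by_contra hout
  obtain ⟨x', hx', hxm⟩ := exists_norm_eq_iInf_of_complete_convex ⟨b, subset_closure hb⟩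
    hcl.isComplete cv.closure y'
  have hpr := (norm_eq_iInf_iff_real_inner_le_zero cv.closure hx').1 hxm
  set w := y' - x' with hw
  have hw0 : w ≠ 0 := by
    intro h; rw [hw, sub_eq_zero] at h; exact hout (h ▸ hx')
  have hwn : 0 < ‖w‖ := norm_pos_iff.2 hw0
  set ν := ‖w‖⁻¹ • w with hνd
  have hν : Nrm Ω x' ν := ⟨norm_smul_inv_norm hw0, fun y hy => by
    rw [hνd, real_inner_smul_left]
    exact mul_nonpos_of_nonneg_of_nonpos (by positivity) (hpr y hy)⟩
  have hyx : 0 < (inner ℝ ν (y' - x') : ℝ) := by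
    rw [← hw, hνd, real_inner_smul_left, real_inner_self_eq_norm_sq]; positivity
  have hxb := hrn x' ν hν
  have hxx := hν.2 x (subset_closure hx)
  -- scaled
  have h3 : (1 + δ * ε) * inner ℝ ν (x' - b) < (inner ℝ ν (x - b) : ℝ) + ε * inner ℝ ν (F x) := by
    have e1 : (inner ℝ ν (x - b) : ℝ) + ε * inner ℝ ν (F x) = (1 + δ * ε) * inner ℝ ν (y' - b) := by
      rw [hy', add_sub_cancel_left, real_inner_smul_right, mul_inv_cancel_left₀ ha.ne',
        ← real_inner_smul_right, ← inner_add_right]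
      congr 1; abel
    rw [e1]
    refine mul_lt_mul_of_pos_left ?_ ha
    rw [show y' - b = (y' - x') + (x' - b) by abel, inner_add_right]; linarith
  have h4 : (inner ℝ ν (x - b) : ℝ) = inner ℝ ν (x' - b) + inner ℝ ν (x - x') := by
    rw [← inner_add_right]; congr 1; abel
  have h6 : (inner ℝ ν (x' - x) : ℝ) = - inner ℝ ν (x - x') := by
    rw [← inner_neg_right]; congr 1; abel
  have h5 : δ * r ≤ inner ℝ ν (F x) := by
    have : δ * ε * r ≤ δ * ε * inner ℝ ν (x' - b) := by gcongr
    have : ε * (δ * r) ≤ ε * inner ℝ ν (F x) := by nlinarith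
    exact le_of_mul_le_mul_left this hε
  have hmem : (x, x', ν) ∈ K1 ∩ K2 := by
    refine ⟨⟨⟨subset_closure hx, hx', by simpa using hν.1⟩, h5⟩, ?_⟩
    simp only [K2, mem_iInter₂, mem_ofPred_eq]
    exact hν.2
  have h7 := hmin _ hmem
  simp only at h7
  have h8 : (inner ℝ ν (F x) : ℝ) ≤ M := by
    have := real_inner_le_norm ν (F x)
    rw [hν.1, one_mul] at this
    exact this.trans (hM x (subset_closure hx))
  have h9 : ε * (M + 1) < m := by rwa [lt_div_iff₀ (by positivity)] at hεm
  have h10 : 0 ≤ δ * ε * inner ℝ ν (x' - b) := by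
    have := hr.le.trans hxb; positivity
  nlinarith [mul_le_mul_of_nonneg_left h8 hε.le]

lemma det_eq (L : E2 →L[ℝ] E2) (ε : ℝ) :
    (ContinuousLinearMap.id ℝ E2 + ε • L).det = 1 + ε * ∑ i, L (ee i) i +
      ε ^ 2 * (L (ee 0) 0 * L (ee 1) 1 - L (ee 1) 0 * L (ee 0) 1) := by
  rw [ContinuousLinearMap.det, ← LinearMap.det_toMatrix (EuclideanSpace.basisFun (Fin 2) ℝ).toBasis,
    Matrix.det_fin_two]
  simp [LinearMap.toMatrix_apply, Fin.sum_univ_two, ee]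
  ring

lemma coord_bound (L : E2 →L[ℝ] E2) (i j : Fin 2) : |L (ee i) j| ≤ ‖L‖ := by
  have h1 := PiLp.norm_apply_le (L (ee i)) j
  have h2 := L.le_opNorm (ee i)
  rw [norm_ee, mul_one] at h2
  exact h1.trans h2

lemma dv_integrable {Ω : Set E2} (op : IsOpen Ω) (bd : Bornology.IsBounded Ω) (cv : Convex ℝ Ω)
    {F : E2 → E2} (hF : ContDiffOn ℝ 1 F (closure Ω)) : IntegrableOn (dv F) Ω := by
  obtain ⟨_, hc, C, hC0, hC⟩ := C1_facts op bd cv hF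
  have hfin : volume Ω < ⊤ := bd.measure_lt_top
  have hcont : ContinuousOn (dv F) Ω := by
    unfold dv
    refine continuousOn_finsetSum _ fun i _ => ?_
    exact (prj i).continuous.comp_continuousOn (hc.clm_apply continuousOn_const)
  refine ⟨hcont.aestronglyMeasurable op.measurableSet, ?_⟩
  refine HasFiniteIntegral.restrict_of_bounded (C := 2 * C) hfin ?_
  refine (ae_restrict_iff' op.measurableSet).2 (Eventually.of_forall fun x hx => ?_)
  rw [dv, Fin.sum_univ_two]
  refine (norm_add_le _ _).trans ?_
  have h0 := (coord_bound (fderiv ℝ F x) 0 0).trans (hC x hx)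
  have h1 := (coord_bound (fderiv ℝ F x) 1 1).trans (hC x hx)
  rw [Real.norm_eq_abs, Real.norm_eq_abs]; linarith

theorem div_le {Ω : Set E2} (op : IsOpen Ω) (bd : Bornology.IsBounded Ω) (cv : Convex ℝ Ω)
    {F : E2 → E2} (hF : ContDiffOn ℝ 1 F (closure Ω))
    (hN : ∀ x ∈ frontier Ω, ∀ ν, Nrm Ω x ν → inner ℝ ν (F x) ≤ (0 : ℝ)) :
    ∫ x in Ω, dv F x ≤ 0 := by
  rcases Ω.eq_empty_or_nonempty with rfl | ⟨b, hb⟩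
  · simp
  obtain ⟨hd, hc, C, hC0, hC⟩ := C1_facts op bd cv hF
  have hint := dv_integrable op bd cv hF
  have hfin : volume Ω < ⊤ := bd.measure_lt_top
  set V : ℝ := volume.real Ω with hV
  have hV0 : 0 ≤ V := measureReal_nonneg
  have hVc : volume.real (closure Ω) = V := by
    rw [hV, measureReal_def, measureReal_def]
    congr 1
    refine le_antisymm ?_ (measure_mono subset_closure)
    calc volume (closure Ω) = volume (Ω ∪ frontier Ω) := by
          rw [op.frontier_eq, union_sdiff_cancel subset_closure]
      _ ≤ volume Ω + volume (frontier Ω) := measure_union_le _ _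
      _ = volume Ω := by rw [cv.addHaar_frontier volume, add_zero]
  have hlip : LipschitzOnWith C.toNNReal F Ω := by
    refine cv.lipschitzOnWith_of_nnnorm_fderiv_le hd fun x hx => ?_
    rw [← NNReal.coe_le_coe, coe_nnnorm, Real.coe_toNNReal _ hC0]; exact hC x hx
  set I := ∫ x in Ω, dv F x with hI
  -- main estimate
  have main : ∀ δ > 0, ∃ ε0 > 0, ∀ ε, 0 < ε → ε < ε0 →
      I ≤ (2 * δ + δ ^ 2 * ε) * V + 2 * C ^ 2 * ε * V := by
    intro δ hδ
    obtain ⟨ε1, hε1, hsub⟩ := flow_contain op bd cv hb hF.continuousOn hN hδ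
    refine ⟨min ε1 (1 / (C + 1)), by positivity, fun ε hε hlt => ?_⟩
    have hsub' := hsub ε hε (hlt.trans_le (min_le_left _ _))
    have hεC : ε * C < 1 := by
      have : ε < 1 / (C + 1) := hlt.trans_le (min_le_right _ _)
      rw [lt_div_iff₀ (by positivity)] at this
      nlinarith
    set Φ : E2 → E2 := fun x => x + ε • F x with hΦ
    have hinj : InjOn Φ Ω := by
      intro x hx y hy hxy
      have h1 := hlip.dist_le_mul x hx y hy
      rw [Real.coe_toNNReal _ hC0, dist_eq_norm, dist_eq_norm] at h1
      have h2 : x - y = - (ε • (F x - F y)) := by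
        have h3 : x + ε • F x = y + ε • F y := hxy
        rw [smul_sub, neg_sub, sub_eq_sub_iff_add_eq_add, h3, add_comm]
      have h3 : ‖x - y‖ = ε * ‖F x - F y‖ := by
        conv_lhs => rw [h2]
        rw [norm_neg, norm_smul, Real.norm_of_nonneg hε.le]
      have h4 : ‖x - y‖ ≤ ε * C * ‖x - y‖ := by
        calc ‖x - y‖ = ε * ‖F x - F y‖ := h3
          _ ≤ ε * (C * ‖x - y‖) := by gcongr
          _ = _ := by ring
      have h5 : ‖x - y‖ = 0 := by nlinarith [norm_nonneg (x - y)]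
      exact sub_eq_zero.1 (norm_eq_zero.1 h5)
    have hΦ' : ∀ x ∈ Ω, HasFDerivWithinAt Φ (ContinuousLinearMap.id ℝ E2 + ε • fderiv ℝ F x) Ω x :=
      fun x hx => ((hasFDerivAt_id x).add ((hd x hx).hasFDerivAt.const_smul ε)).hasFDerivWithinAt
    have himg := integral_image_eq_integral_abs_det_fderiv_smul volume op.measurableSet hΦ' hinj
      (fun _ => (1:ℝ))
    have hle : volume.real (Φ '' Ω) ≤ (1 + δ * ε) ^ 2 * V := by
      have h1 : Φ '' Ω ⊆ AffineMap.homothety b (1 + δ * ε) '' closure Ω := by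
        rintro _ ⟨x, hx, rfl⟩; exact hsub' x hx
      have h2 : volume (AffineMap.homothety b (1 + δ * ε) '' closure Ω) =
          ENNReal.ofReal ((1 + δ * ε) ^ 2) * volume (closure Ω) := by
        rw [Measure.addHaar_image_homothety]; simp
      have h3 : volume (AffineMap.homothety b (1 + δ * ε) '' closure Ω) ≠ ⊤ := by
        rw [h2]; exact ENNReal.mul_ne_top (by simp) bd.isCompact_closure.measure_lt_top.ne
      calc volume.real (Φ '' Ω) ≤ volume.real (AffineMap.homothety b (1 + δ * ε) '' closure Ω) :=
            measureReal_mono h1 h3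
        _ = (1 + δ * ε) ^ 2 * V := by
            rw [measureReal_def, h2, ENNReal.toReal_mul, ENNReal.toReal_ofReal (by positivity),
              ← measureReal_def, hVc]
    have hfinI : volume (Φ '' Ω) < ⊤ := by
      have h1 : Φ '' Ω ⊆ AffineMap.homothety b (1 + δ * ε) '' closure Ω := by
        rintro _ ⟨x, hx, rfl⟩; exact hsub' x hx
      refine (measure_mono h1).trans_lt ?_
      rw [Measure.addHaar_image_homothety]
      exact ENNReal.mul_lt_top (by simp) bd.isCompact_closure.measure_lt_top
    have hintd := (integrableOn_image_iff_integrableOn_abs_det_fderiv_smul volume op.measurableSet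
      hΦ' hinj (fun _ => (1:ℝ))).1 (integrableOn_const hfinI.ne)
    simp only [smul_eq_mul, mul_one] at himg hintd
    have e1 : ∫ x in Φ '' Ω, (1:ℝ) = volume.real (Φ '' Ω) := by simp
    rw [e1] at himg
    have hlow : ∫ x in Ω, ((1 - 2 * C ^ 2 * ε ^ 2) + ε * dv F x) ≤
        ∫ x in Ω, |(ContinuousLinearMap.id ℝ E2 + ε • fderiv ℝ F x).det| := by
      refine setIntegral_mono_on ?_ hintd op.measurableSet fun x hx => ?_
      · exact (integrableOn_const hfin.ne).add (hint.const_mul ε)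
      · refine le_trans ?_ (le_abs_self _)
        rw [det_eq]
        have b1 : ∀ i j, |fderiv ℝ F x (ee i) j| ≤ C := fun i j =>
          (coord_bound _ i j).trans (hC x hx)
        have b2 : ∀ i j i' j', |fderiv ℝ F x (ee i) j * fderiv ℝ F x (ee i') j'| ≤ C * C :=
          fun i j i' j' => by
            rw [abs_mul]; exact mul_le_mul (b1 _ _) (b1 _ _) (abs_nonneg _) hC0
        have b3 := (abs_le.1 (b2 0 0 1 1)).1
        have b4 := (abs_le.1 (b2 1 0 0 1)).2
        change _ ≤ 1 + ε * dv F x + _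
        nlinarith [sq_nonneg ε]
    have hci : IntegrableOn (fun _ : E2 => 1 - 2 * C ^ 2 * ε ^ 2) Ω := integrableOn_const hfin.ne
    rw [integral_add hci (hint.const_mul ε), integral_const_mul,
      ← himg] at hlow
    rw [← hI] at hlow
    have e2 : ∫ x in Ω, (1 - 2 * C ^ 2 * ε ^ 2) = (1 - 2 * C ^ 2 * ε ^ 2) * V := by
      simp [hV, mul_comm]
    rw [e2] at hlow
    have h5 : ε * I ≤ ε * ((2 * δ + δ ^ 2 * ε) * V + 2 * C ^ 2 * ε * V) := by nlinarith
    exact le_of_mul_le_mul_left h5 hε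
  have main2 : ∀ δ > 0, I ≤ 2 * δ * V := by
    intro δ hδ
    obtain ⟨ε0, h0, h⟩ := main δ hδ
    have ht : Tendsto (fun ε : ℝ => (2 * δ + δ ^ 2 * ε) * V + 2 * C ^ 2 * ε * V) (𝓝[>] 0)
        (𝓝 ((2 * δ + δ ^ 2 * 0) * V + 2 * C ^ 2 * 0 * V)) := by
      refine (Continuous.tendsto ?_ 0).mono_left nhdsWithin_le_nhds
      fun_prop
    have := ge_of_tendsto ht (by
      filter_upwards [Ioo_mem_nhdsGT h0] with ε hε using h ε hε.1 hε.2)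
    simpa using this
  have ht : Tendsto (fun δ : ℝ => 2 * δ * V) (𝓝[>] 0) (𝓝 (2 * 0 * V)) := by
    refine (Continuous.tendsto ?_ 0).mono_left nhdsWithin_le_nhds
    fun_prop
  have := ge_of_tendsto ht (by filter_upwards [self_mem_nhdsWithin] with δ hδ using main2 δ hδ)
  simpa using this

lemma deriv_zero_of_Ioc {P : ℝ → ℝ} {P' t T : ℝ} (h0 : 0 < t) (hT : t ≤ T)
    (hP : HasDerivAt P P' t) (h : ∀ s, 0 < s → s ≤ T → P s = 0) : P' = 0 := by
  have h1 : HasDerivWithinAt P P' (Ioc 0 T) t := hP.hasDerivWithinAt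
  have h2 : HasDerivWithinAt P 0 (Ioc 0 T) t :=
    (hasDerivWithinAt_const t (Ioc 0 T) (0:ℝ)).congr (fun s hs => h s hs.1 hs.2) (h t h0 hT)
  exact (uniqueDiffOn_Ioc 0 T t ⟨h0, hT⟩).eq_deriv _ h1 h2

lemma zero_at_zero {P : ℝ → ℝ} {T : ℝ} (hT : 0 < T) (hP : ContinuousAt P 0)
    (h : ∀ s, 0 < s → s ≤ T → P s = 0) : P 0 = 0 := by
  have h1 : Tendsto P (𝓝[>] 0) (𝓝 (P 0)) := hP.tendsto.mono_left nhdsWithin_le_nhds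
  refine tendsto_nhds_unique h1 (tendsto_const_nhds.congr' ?_)
  filter_upwards [Ioo_mem_nhdsGT hT] with s hs using (h s hs.1 hs.2.le).symm

lemma ellOp_zero {k v : E2 → ℝ} {x : E2} (h : v =ᶠ[𝓝 x] fun _ => 0) : ellOp k v x = 0 := by
  have h1 : gradient v =ᶠ[𝓝 x] fun _ => 0 := by
    filter_upwards [h.fderiv (𝕜 := ℝ)] with y hy
    rw [gradient_eq_toDual]; simp [hy]
  have h2 : (fun y => k y • gradient v y) =ᶠ[𝓝 x] fun _ => 0 := by
    filter_upwards [h1] with y hy; simp [hy]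
  unfold ellOp
  rw [h2.fderiv_eq]; simp

lemma sol_Dt {Ω T k μ k₁ k₂} (D : Dom Ω T k μ k₁ k₂) {c : E2 → ℝ} {f z : E2 → ℝ → ℝ}
    (hz : Sm z) (hf : Sm f) (hs : IsDirectSolution Ω T k μ c f z) (hf0 : ∀ x ∈ Ω, f x 0 = 0) :
    IsDirectSolution Ω T k μ c (Dt f) (Dt z) := by
  have hP : ∀ x ∈ Ω, ∀ t, HasDerivAt
      (fun s => Dt z x s + ellOp k (fun y => z y s) x + c x * z x s - f x s)
      (Dt (Dt z) x t + ellOp k (fun y => Dt z y t) x + c x * Dt z x t - Dt f x t) t := by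
    intro x hx t
    exact (((hz.Dt.hasDerivAt x t).add (ellOp_hasDerivAt (D.diff hx) hz t)).add
      ((hz.hasDerivAt x t).const_mul _)).sub (hf.hasDerivAt x t)
  have hP0 : ∀ x ∈ Ω, ∀ s, 0 < s → s ≤ T →
      Dt z x s + ellOp k (fun y => z y s) x + c x * z x s - f x s = 0 := fun x hx s h0 h1 =>
    sub_eq_zero.2 (hs.pde x hx s h0 h1)
  refine ⟨fun x hx t h0 h1 => ?_, fun x hx => ?_, fun x hx ν hν hν2 t h0 h1 => ?_⟩
  · exact sub_eq_zero.1 (deriv_zero_of_Ioc h0 h1 (hP x hx t) (hP0 x hx))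
  · have h := zero_at_zero D.hT (hP x hx 0).continuousAt (hP0 x hx)
    have he : ellOp k (fun y => z y 0) x = 0 := ellOp_zero (by
      filter_upwards [D.op.mem_nhds hx] with y hy using hs.ic y hy)
    rw [he, hs.ic x hx, hf0 x hx] at h
    linarith
  · have h2 : HasDerivAt (fun s => k x * Dw ν z x s + μ x * z x s)
        (k x * Dt (Dw ν z) x t + μ x * Dt z x t) t :=
      (((hz.Dw ν).hasDerivAt x t).const_mul _).add ((hz.hasDerivAt x t).const_mul _)
    have := deriv_zero_of_Ioc h0 h1 h2 (fun s h0 h1 => hs.robin x hx ν hν hν2 s h0 h1)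
    rw [hz.Dt_Dw] at this
    exact this

lemma ellOp_sub {k v w : E2 → ℝ} {x : E2} (hk : DifferentiableAt ℝ k x)
    (hv : ContDiff ℝ 2 v) (hw : ContDiff ℝ 2 w) :
    ellOp k (fun y => v y - w y) x = ellOp k v x - ellOp k w x := by
  have h := ellOp_add_mul hk hv hw (-1)
  have e : (fun y => v y + -1 * w y) = fun y => v y - w y := by ext y; ring
  rw [e] at h; rw [h]; ring

lemma sol_diff {Ω T k μ k₁ k₂} (D : Dom Ω T k μ k₁ k₂) {c q : E2 → ℝ} {f z w : E2 → ℝ → ℝ}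
    (hz : Sm z) (hw : Sm w) (hs : IsDirectSolution Ω T k μ c f z)
    (hs' : IsDirectSolution Ω T k μ q f w) :
    IsDirectSolution Ω T k μ q (fun x t => (q x - c x) * z x t) (fun x t => z x t - w x t) := by
  refine ⟨fun x hx t h0 h1 => ?_, fun x hx => ?_, fun x hx ν hν hν2 t h0 h1 => ?_⟩
  · rw [ellOp_sub (D.diff hx) ((hz.slice_x t).of_le two_le) ((hw.slice_x t).of_le two_le)]
    have e : deriv (fun t => z x t - w x t) t = deriv (z x) t - deriv (w x) t :=
      ((hz.hasDerivAt x t).sub (hw.hasDerivAt x t)).deriv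
    rw [e]
    linear_combination hs.pde x hx t h0 h1 - hs'.pde x hx t h0 h1
  · rw [hs.ic x hx, hs'.ic x hx, sub_zero]
  · rw [fderiv_fun_sub ((hz.slice_x t).differentiable (by simp) x)
      ((hw.slice_x t).differentiable (by simp) x)]
    simp only [ContinuousLinearMap.sub_apply]
    linear_combination hs.robin x hx ν hν hν2 t h0 h1 - hs'.robin x hx ν hν hν2 t h0 h1

/-- smoothed step -/
def hS (ε s : ℝ) : ℝ := Real.smoothTransition (-s / ε)

/-- smoothed negative part -/
def gS (ε s : ℝ) : ℝ := ∫ τ in s..0, hS ε τ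

lemma hS_contDiff (ε : ℝ) : ContDiff ℝ ∞ (hS ε) :=
  Real.smoothTransition.contDiff.comp (contDiff_neg.div_const ε)

lemma hS_nonneg (ε s : ℝ) : 0 ≤ hS ε s := Real.smoothTransition.nonneg _
lemma hS_le_one (ε s : ℝ) : hS ε s ≤ 1 := Real.smoothTransition.le_one _
lemma hS_zero {ε s : ℝ} (hε : 0 < ε) (hs : 0 ≤ s) : hS ε s = 0 :=
  Real.smoothTransition.zero_of_nonpos (div_nonpos_of_nonpos_of_nonneg (by linarith) hε.le)
lemma hS_one {ε s : ℝ} (hε : 0 < ε) (hs : s ≤ -ε) : hS ε s = 1 :=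
  Real.smoothTransition.one_of_one_le (by rw [le_div_iff₀ hε]; linarith)
lemma hS_anti {ε : ℝ} (hε : 0 < ε) : Antitone (hS ε) := fun a b hab =>
  Real.smoothTransition.monotone (by gcongr)

lemma hS_ii (ε a b : ℝ) : IntervalIntegrable (hS ε) volume a b :=
  (hS_contDiff ε).continuous.intervalIntegrable _ _

lemma gS_deriv (ε s : ℝ) : HasDerivAt (gS ε) (- hS ε s) s :=
  intervalIntegral.integral_hasDerivAt_left (hS_ii ε s 0)
    ((hS_contDiff ε).continuous.stronglyMeasurableAtFilter _ _)
    (hS_contDiff ε).continuous.continuousAt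

lemma gS_contDiff (ε : ℝ) : ContDiff ℝ 1 (gS ε) := by
  rw [contDiff_one_iff_deriv]
  have : deriv (gS ε) = fun s => - hS ε s := by ext s; exact (gS_deriv ε s).deriv
  rw [this]
  exact ⟨fun s => (gS_deriv ε s).differentiableAt, (hS_contDiff ε).continuous.neg⟩

lemma gS_zero {ε s : ℝ} (hε : 0 < ε) (hs : 0 ≤ s) : gS ε s = 0 := by
  unfold gS
  rw [intervalIntegral.integral_congr (g := fun _ => 0)]
  · simp
  · intro τ hτ
    rw [uIcc_of_ge hs] at hτ
    exact hS_zero hε hτ.1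

lemma gS_nonneg {ε : ℝ} (hε : 0 < ε) (s : ℝ) : 0 ≤ gS ε s := by
  rcases le_total 0 s with h | h
  · rw [gS_zero hε h]
  · exact intervalIntegral.integral_nonneg h fun τ _ => hS_nonneg ε τ

lemma gS_le {ε : ℝ} (hε : 0 < ε) (s : ℝ) : gS ε s ≤ - s * hS ε s := by
  rcases le_total 0 s with h | h
  · rw [gS_zero hε h, hS_zero hε h, mul_zero]
  · have := intervalIntegral.integral_mono_on h (hS_ii ε s 0)
      (intervalIntegrable_const (c := hS ε s)) fun τ hτ => hS_anti hε hτ.1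
    simpa [gS] using this

lemma gS_ge {ε : ℝ} (hε : 0 < ε) (s : ℝ) : max (-s) 0 - ε ≤ gS ε s := by
  rcases le_total s (-ε) with h | h
  · have h1 : gS ε s = (∫ τ in s..(-ε), hS ε τ) + gS ε (-ε) :=
      (intervalIntegral.integral_add_adjacent_intervals (hS_ii _ _ _) (hS_ii _ _ _)).symm
    have h2 : ∫ τ in s..(-ε), hS ε τ = ∫ τ in s..(-ε), (1:ℝ) :=
      intervalIntegral.integral_congr fun τ hτ => by
        rw [uIcc_of_le h] at hτ; exact hS_one hε hτ.2
    have h3 := gS_nonneg hε (-ε)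
    rw [h1, h2, max_eq_left (by linarith)]
    simp; linarith
  · have := gS_nonneg hε s
    have : max (-s) 0 ≤ ε := max_le (by linarith) hε.le
    linarith

/-- the weight -/
def phi (M l : ℝ) (b x : E2) : ℝ := M - Real.exp (-l * sqd b x)

lemma phi_contDiff (M l : ℝ) (b : E2) {n : WithTop ℕ∞} : ContDiff ℝ n (phi M l b) :=
  contDiff_const.sub ((contDiff_const.mul (sqd_contDiff b)).exp)

lemma exp_sqd_hasFDerivAt (l : ℝ) (b x : E2) :
    HasFDerivAt (fun y => Real.exp (-l * sqd b y))
      (Real.exp (-l * sqd b x) • (-l • fderiv ℝ (sqd b) x)) x :=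
  ((((sqd_contDiff b (n := 1)).differentiable (by norm_num) x).hasFDerivAt).const_mul (-l)).exp

lemma phi_fderiv (M l : ℝ) (b x w : E2) :
    fderiv ℝ (phi M l b) x w = 2 * l * Real.exp (-l * sqd b x) * inner ℝ (x - b) w := by
  have h := (exp_sqd_hasFDerivAt l b x).const_sub M
  rw [show phi M l b = fun y => M - Real.exp (-l * sqd b y) from rfl, h.fderiv]
  simp [sqd_fderiv]; ring

lemma phi_pd (M l : ℝ) (b x : E2) (i : Fin 2) :
    pd i (phi M l b) x = Real.exp (-l * sqd b x) * (2 * l * (x i - b i)) := by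
  rw [pd, phi_fderiv, ee, EuclideanSpace.inner_single_right]; simp; ring

lemma phi_pd2 (M l : ℝ) (b x : E2) (i : Fin 2) :
    pd i (pd i (phi M l b)) x =
      Real.exp (-l * sqd b x) * (2 * l - 4 * l ^ 2 * (x i - b i) ^ 2) := by
  have : pd i (phi M l b) = fun x => Real.exp (-l * sqd b x) * (2 * l * (x i - b i)) := by
    ext x; exact phi_pd M l b x i
  have hd : DifferentiableAt ℝ (fun y : E2 => 2 * l * (y i - b i)) x := by
    have := ((prj i).differentiableAt (x := x)).sub_const (b i)
    exact this.const_mul (2 * l)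
  rw [this, pd_mul (exp_sqd_hasFDerivAt l b x).differentiableAt hd, coord_fderiv]
  have h2 : pd i (fun y => Real.exp (-l * sqd b y)) x
      = Real.exp (-l * sqd b x) * (-l * (2 * (x i - b i))) := by
    rw [← sqd_pd b x i, pd, (exp_sqd_hasFDerivAt l b x).fderiv]; rfl
  rw [h2]; ring

lemma phi_ellOp {k : E2 → ℝ} (M l : ℝ) (b x : E2) (hk : DifferentiableAt ℝ k x) :
    ellOp k (phi M l b) x = l * Real.exp (-l * sqd b x) *
      (4 * (k x * (l * ‖x - b‖ ^ 2 - 1)) - 2 * ∑ i, (x i - b i) * pd i k x) := by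
  rw [ellOp_eq hk (phi_contDiff M l b)]
  have : ‖x - b‖ ^ 2 = (x 0 - b 0) ^ 2 + (x 1 - b 1) ^ 2 := by
    rw [EuclideanSpace.norm_sq_eq]; simp
  simp only [phi_pd2, phi_pd, this, Fin.sum_univ_two]
  ring

lemma weight {Ω T k μ k₁ k₂} (D : Dom Ω T k μ k₁ k₂) {q : E2 → ℝ} (hq : ∀ x ∈ Ω, 0 ≤ q x)
    {b : E2} (hb : b ∈ Ω) {ρ q0 : ℝ} (hρ : 0 < ρ) (hq0 : 0 < q0)
    (hqb : ∀ x ∈ Ω, ‖x - b‖ < ρ → q0 ≤ q x) :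
    ∃ (φ : E2 → ℝ) (M κ : ℝ), ContDiff ℝ ∞ φ ∧ 0 < κ ∧ (∀ x, 0 ≤ φ x ∧ φ x ≤ M) ∧
      (∀ x ∈ frontier Ω, ∀ ν, Nrm Ω x ν → 0 ≤ fderiv ℝ φ x ν) ∧
      ∀ x ∈ Ω, κ ≤ q x * φ x + ellOp k φ x := by
  obtain ⟨K, hK0, hK⟩ := D.exK
  obtain ⟨R, hR0, hR⟩ := D.exR b
  have hk₁ := D.hk₁
  have hk2 : 0 ≤ k₂ := by
    obtain ⟨x, hx⟩ := D.ne
    have := D.hkbd x (subset_closure hx); linarith [D.hk₁]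
  set L := (K + 1) / (k₁ * ρ) with hL
  have hLpos : 0 < L := by positivity
  have hLe : k₁ * L * ρ = K + 1 := by rw [hL]; field_simp
  set l := 1 / ρ ^ 2 + L with hl
  have hlpos : 0 < l := by positivity
  set C1 := l * (4 * k₂ + 4 * (K * R)) with hC1
  have hC1' : 0 ≤ C1 := by positivity
  set M := 1 + (C1 + 1) / q0 with hM
  have hexp1 : ∀ x, Real.exp (-l * sqd b x) ≤ 1 := fun x => by
    rw [Real.exp_le_one_iff]
    have : 0 ≤ sqd b x := by unfold sqd; positivity
    nlinarith
  have hM1 : 0 ≤ (C1 + 1) / q0 := by positivity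
  have hφ1 : ∀ x, (C1 + 1) / q0 ≤ phi M l b x := fun x => by
    unfold phi; linarith [hexp1 x]
  have hsum : ∀ x ∈ Ω, ∑ i, (x i - b i) * pd i k x ≤ 2 * (K * ‖x - b‖) := fun x hx => by
    have : ∀ i, (x i - b i) * pd i k x ≤ K * ‖x - b‖ := fun i => by
      refine (le_abs_self _).trans ?_
      rw [abs_mul, mul_comm]
      exact mul_le_mul (hK x hx i) (coord_le x b i) (abs_nonneg _) hK0
    rw [Fin.sum_univ_two]; linarith [this 0, this 1]
  refine ⟨phi M l b, M, min 1 (l * Real.exp (-l * R ^ 2) * (4 * ρ)), phi_contDiff M l b,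
    by positivity, fun x => ⟨hM1.trans (hφ1 x), ?_⟩, ?_, ?_⟩
  · unfold phi; linarith [Real.exp_pos (-l * sqd b x)]
  · intro x hx ν hν
    rw [phi_fderiv]
    have := nrm_pos D.op hν hb
    rw [real_inner_comm] at this
    positivity
  · intro x hx
    have hkx := D.hkbd x (subset_closure hx)
    have hs := hsum x hx
    have hr0 := norm_nonneg (x - b)
    have hrR := hR x hx
    rw [phi_ellOp M l b x (D.diff hx)]
    set r := ‖x - b‖ with hr
    set E := Real.exp (-l * sqd b x) with hE
    have hEp : 0 < E := Real.exp_pos _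
    rcases lt_or_ge r ρ with h | h
    · refine (min_le_left _ _).trans ?_
      have h1 : C1 + 1 ≤ q x * phi M l b x := by
        have := mul_le_mul (hqb x hx h) (hφ1 x) hM1 (hq x hx)
        rwa [mul_div_cancel₀ _ hq0.ne'] at this
      have h2 : -(4 * k₂ + 4 * (K * R)) ≤
          4 * (k x * (l * r ^ 2 - 1)) - 2 * ∑ i, (x i - b i) * pd i k x := by
        have a1 : K * r ≤ K * R := by gcongr
        have a2 : 0 ≤ k x * (l * r ^ 2) := by
          have : 0 ≤ k x := by linarith
          positivity
        nlinarith
      have h3 : l * E * -(4 * k₂ + 4 * (K * R)) ≤ l * E *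
          (4 * (k x * (l * r ^ 2 - 1)) - 2 * ∑ i, (x i - b i) * pd i k x) :=
        mul_le_mul_of_nonneg_left h2 (by positivity)
      have h4 : -C1 ≤ l * E * -(4 * k₂ + 4 * (K * R)) := by
        have : E * C1 ≤ 1 * C1 := mul_le_mul_of_nonneg_right (hexp1 x) hC1'
        rw [hC1] at this ⊢; nlinarith
      linarith
    · refine (min_le_right _ _).trans ?_
      have h1 : 0 ≤ q x * phi M l b x := mul_nonneg (hq x hx) (hM1.trans (hφ1 x))
      have h2 : 4 * ρ ≤ 4 * (k x * (l * r ^ 2 - 1)) - 2 * ∑ i, (x i - b i) * pd i k x := by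
        have a1 : L * r ^ 2 ≤ l * r ^ 2 - 1 := by
          have : 1 ≤ 1 / ρ ^ 2 * r ^ 2 := by
            rw [div_mul_eq_mul_div, one_mul, one_le_div (by positivity)]
            gcongr
          rw [hl]; linarith
        have a2 : k₁ * (L * r ^ 2) ≤ k x * (l * r ^ 2 - 1) :=
          mul_le_mul hkx.1 a1 (by positivity) (by linarith)
        have a3 : k₁ * L * ρ * r ≤ k₁ * (L * r ^ 2) := by
          have : ρ * r ≤ r * r := by gcongr
          have := mul_le_mul_of_nonneg_left this (by positivity : 0 ≤ k₁ * L)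
          linarith
        rw [hLe] at a3
        linarith
      have h3 : Real.exp (-l * R ^ 2) ≤ E := by
        rw [hE, Real.exp_le_exp]
        have : sqd b x ≤ R ^ 2 := by unfold sqd; gcongr
        nlinarith
      have h4 : l * Real.exp (-l * R ^ 2) * (4 * ρ) ≤ l * E * (4 * ρ) := by gcongr
      have h5 := mul_le_mul_of_nonneg_left h2 (by positivity : 0 ≤ l * E)
      linarith

lemma hS_mul_nonpos {ε : ℝ} (hε : 0 < ε) (s : ℝ) : hS ε s * s ≤ 0 := by
  rcases le_total 0 s with h | h
  · rw [hS_zero hε h, zero_mul]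
  · exact mul_nonpos_of_nonneg_of_nonpos (hS_nonneg _ _) h

lemma pd_comp {g : ℝ → ℝ} {g' : ℝ} {v : E2 → ℝ} {x : E2} (hg : HasDerivAt g g' (v x))
    (hv : DifferentiableAt ℝ v x) (i : Fin 2) : pd i (fun y => g (v y)) x = g' * pd i v x := by
  have := hg.comp_hasFDerivAt x hv.hasFDerivAt
  rw [pd, show (fun y => g (v y)) = g ∘ v from rfl, this.fderiv]; rfl

lemma pd_neg {a : E2 → ℝ} {x : E2} (i : Fin 2) : pd i (fun y => - a y) x = - pd i a x := by
  unfold pd; rw [fderiv_fun_neg]; rfl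

lemma space_ineq {Ω T k μ k₁ k₂} (D : Dom Ω T k μ k₁ k₂) {φ v : E2 → ℝ} (hφ : ContDiff ℝ ∞ φ)
    (hφ0 : ∀ x, 0 ≤ φ x) (hφν : ∀ x ∈ frontier Ω, ∀ ν, Nrm Ω x ν → 0 ≤ fderiv ℝ φ x ν)
    (hv : ContDiff ℝ ∞ v)
    (hr : ∀ x ∈ frontier Ω, ∀ ν, Nrm Ω x ν → k x * fderiv ℝ v x ν + μ x * v x = 0)
    {ε : ℝ} (hε : 0 < ε) :
    ∫ x in Ω, (gS ε (v x) * ellOp k φ x + φ x * hS ε (v x) * ellOp k v x) ≤ 0 := by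
  by_cases hI : IntegrableOn
    (fun x => gS ε (v x) * ellOp k φ x + φ x * hS ε (v x) * ellOp k v x) Ω
  swap
  · rw [integral_undef hI]
  have hv2 := hv.of_le two_le
  have hφ2 := hφ.of_le two_le
  have hv1 : ContDiff ℝ 1 v := hv2.of_le (by norm_num)
  have hφ1 : ContDiff ℝ 1 φ := hφ2.of_le (by norm_num)
  have hh1 : ContDiff ℝ 1 (hS ε) := ((hS_contDiff ε).of_le two_le).of_le (by norm_num)
  set a : E2 → ℝ := fun y => -(φ y * hS ε (v y)) with ha
  set g : E2 → ℝ := fun y => gS ε (v y) with hg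
  have haC : ContDiff ℝ 1 a := (hφ1.mul (hh1.comp hv1)).neg
  have hgC : ContDiff ℝ 1 g := (gS_contDiff ε).comp hv1
  set F : E2 → E2 := fun y => k y • (a y • gradient v y - g y • gradient φ y) with hF
  have hFC : ContDiffOn ℝ 1 F (closure Ω) := D.hkC1.smul
    ((haC.smul (contDiff_gradient hv2 (by norm_num))).sub
      (hgC.smul (contDiff_gradient hφ2 (by norm_num)))).contDiffOn
  have hdiv := div_le D.op D.bd D.cv hFC (fun x hx ν hν => by
    have e : inner ℝ ν (F x) = a x * (k x * fderiv ℝ v x ν) - k x * g x * fderiv ℝ φ x ν := by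
      rw [hF]
      simp only [inner_smul_right, inner_sub_right]
      rw [real_inner_comm, inner_gradient, real_inner_comm, inner_gradient]; ring
    have h1 : k x * fderiv ℝ v x ν = - (μ x * v x) := by linarith [hr x hx ν hν]
    rw [e, h1]
    have hk0 : 0 ≤ k x := by linarith [(D.hkbd x (frontier_subset_closure hx)).1, D.hk₁]
    have h2 : 0 ≤ k x * g x * fderiv ℝ φ x ν :=
      mul_nonneg (mul_nonneg hk0 (gS_nonneg hε _)) (hφν x hx ν hν)
    have h3 : (φ x * μ x) * (hS ε (v x) * v x) ≤ 0 :=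
      mul_nonpos_of_nonneg_of_nonpos (mul_nonneg (hφ0 x) (D.hμ x hx)) (hS_mul_nonpos hε _)
    have h4 : a x * -(μ x * v x) = (φ x * μ x) * (hS ε (v x) * v x) := by rw [ha]; ring
    linarith)
  refine le_trans (setIntegral_mono_on hI (dv_integrable D.op D.bd D.cv hFC)
    D.op.measurableSet fun x hx => ?_) hdiv
  have hk := D.diff hx
  have dv1 := hv1.differentiable (by norm_num) x
  have dφ1 := hφ1.differentiable (by norm_num) x
  have da := haC.differentiable (by norm_num) x
  have dg := hgC.differentiable (by norm_num) x
  have hFd : DifferentiableAt ℝ F x := (C1_facts D.op D.bd D.cv hFC).1 x hx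
  rw [dv_eq F x hFd, ellOp_eq hk hφ2, ellOp_eq hk hv2]
  have hh' : HasDerivAt (hS ε) (deriv (hS ε) (v x)) (v x) :=
    (hh1.differentiable (by norm_num) _).hasDerivAt
  have hneg : deriv (hS ε) (v x) ≤ 0 := (hS_anti hε).deriv_nonpos
  have hk0 : 0 ≤ k x := by linarith [(D.hkbd x (subset_closure hx)).1, D.hk₁]
  have key : ∀ i, pd i (fun y => F y i) x =
      a x * (k x * pd i (pd i v) x + pd i v x * pd i k x)
      - g x * (k x * pd i (pd i φ) x + pd i φ x * pd i k x)
      - φ x * k x * deriv (hS ε) (v x) * (pd i v x) ^ 2 := by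
    intro i
    have hpv : DifferentiableAt ℝ (pd i v) x :=
      (contDiff_pd (m := 1) hv2 (by norm_num) i).differentiable (by norm_num) x
    have hpφ : DifferentiableAt ℝ (pd i φ) x :=
      (contDiff_pd (m := 1) hφ2 (by norm_num) i).differentiable (by norm_num) x
    have e : (fun y => F y i) = fun y => k y * (a y * pd i v y + (- g y) * pd i φ y) := by
      ext y; simp only [hF, PiLp.smul_apply, PiLp.sub_apply, gradient_coord, smul_eq_mul]; ring
    have ea : pd i a x = -(φ x * (deriv (hS ε) (v x) * pd i v x) + hS ε (v x) * pd i φ x) := by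
      have hc : DifferentiableAt ℝ (fun y => hS ε (v y)) x := hh'.differentiableAt.comp x dv1
      rw [ha, pd_neg, pd_mul dφ1 hc, pd_comp hh' dv1]
    have eg : pd i (fun y => - g y) x = hS ε (v x) * pd i v x := by
      rw [pd_neg, hg, pd_comp (gS_deriv ε (v x)) dv1]; ring
    have d1 : DifferentiableAt ℝ (fun y => a y * pd i v y) x := da.mul hpv
    have d0 : DifferentiableAt ℝ (fun y => - g y) x := dg.neg
    have d2 : DifferentiableAt ℝ (fun y => - g y * pd i φ y) x := d0.mul hpφ
    have d3 : DifferentiableAt ℝ (fun y => a y * pd i v y + - g y * pd i φ y) x := d1.add d2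
    rw [e, pd_mul hk d3, pd_add d1 d2, pd_mul da hpv, pd_mul d0 hpφ, ea, eg, ha]
    ring
  have hpos : ∀ i, φ x * k x * deriv (hS ε) (v x) * (pd i v x) ^ 2 ≤ 0 := fun i =>
    mul_nonpos_of_nonpos_of_nonneg
      (mul_nonpos_of_nonneg_of_nonpos (mul_nonneg (hφ0 x) hk0) hneg) (sq_nonneg _)
  simp only [Fin.sum_univ_two, key]
  have := hpos 0
  have := hpos 1
  simp only [ha, hg]
  linarith

lemma int2 {Ω : Set E2} (op : IsOpen Ω) (bd : Bornology.IsBounded Ω) (T : ℝ)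
    {A : E2 × ℝ → ℝ} (hA : Continuous A) {m : E2 → ℝ} (hm : ContinuousOn m Ω) {C : ℝ}
    (hC : ∀ x ∈ Ω, |m x| ≤ C) :
    Integrable (fun p : E2 × ℝ => A p * m p.1)
      ((volume.restrict Ω).prod (volume.restrict (Ioc 0 T))) := by
  rw [Measure.prod_restrict]
  have hc : IsCompact (closure Ω ×ˢ Icc (0:ℝ) T) :=
    (Metric.isCompact_of_isClosed_isBounded isClosed_closure bd.closure).prod isCompact_Icc
  obtain ⟨B, hB⟩ := hc.exists_bound_of_continuousOn hA.continuousOn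
  have hms : MeasurableSet (Ω ×ˢ Ioc (0:ℝ) T) := op.measurableSet.prod measurableSet_Ioc
  have hsub : Ω ×ˢ Ioc (0:ℝ) T ⊆ closure Ω ×ˢ Icc (0:ℝ) T :=
    prod_mono subset_closure Ioc_subset_Icc_self
  have hfin : IsFiniteMeasure ((volume.prod volume).restrict (Ω ×ˢ Ioc (0:ℝ) T) : Measure (E2 × ℝ)) :=
    ⟨by rw [Measure.restrict_apply_univ]; exact (measure_mono hsub).trans_lt hc.measure_lt_top⟩
  refine Integrable.of_bound (C := B * C) ?_ ?_
  · exact (hA.continuousOn.mul (hm.comp continuousOn_fst fun p hp => hp.1)).aestronglyMeasurable hms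
  · filter_upwards [ae_restrict_mem hms] with p hp
    rw [norm_mul]
    exact mul_le_mul (hB p (hsub hp)) (hC _ hp.1) (norm_nonneg _) ((norm_nonneg _).trans (hB p (hsub hp)))

lemma pdk_cont {Ω T k μ k₁ k₂} (D : Dom Ω T k μ k₁ k₂) (i : Fin 2) :
    ContinuousOn (fun x => pd i k x) Ω :=
  (C1_facts D.op D.bd D.cv D.hkC1).2.1.clm_apply continuousOn_const

lemma k_cont {Ω T k μ k₁ k₂} (D : Dom Ω T k μ k₁ k₂) : ContinuousOn k Ω :=
  fun _ hx => (D.diff hx).continuousAt.continuousWithinAt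

theorem L1 {Ω T k μ k₁ k₂} (D : Dom Ω T k μ k₁ k₂) {q d : E2 → ℝ} {u z : E2 → ℝ → ℝ}
    (hq : ∀ x ∈ Ω, 0 ≤ q x)
    {b : E2} (hb : b ∈ Ω) {ρ q0 : ℝ} (hρ : 0 < ρ) (hq0 : 0 < q0)
    (hqb : ∀ x ∈ Ω, ‖x - b‖ < ρ → q0 ≤ q x)
    (hu : Sm u) (hu0 : ∀ x ∈ Ω, u x 0 = 0) (huT : ∀ x ∈ Ω, 0 < u x T)
    (hut : ∀ x ∈ Ω, ∀ t, 0 ≤ t → t ≤ T → 0 ≤ Dt u x t)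
    (hz : Sm z) (hs : IsDirectSolution Ω T k μ q (fun x t => d x * Dt u x t) z)
    (hzT : ∀ x ∈ Ω, z x T ≤ d x * u x T) :
    ∀ x ∈ Ω, ∀ t, 0 < t → t < T → 0 ≤ z x t := by
  obtain ⟨φ, M, κ, hφ, hκ, hφM, hφν, hκφ⟩ := weight D hq hb hρ hq0 hqb
  have hT := D.hT
  obtain ⟨K, hK0, hK⟩ := D.exK
  set N : E2 → ℝ → ℝ := fun x t => max (-z x t) 0 with hN
  have hNc : Continuous (Function.uncurry N) := hz.cont.neg.max continuous_const
  have hNi : Integrable (Function.uncurry N)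
      ((volume.restrict Ω).prod (volume.restrict (Ioc 0 T))) := by
    have := int2 D.op D.bd T hNc (m := fun _ => 1) continuousOn_const (C := 1) (by simp)
    simpa using this
  have hfinΩ : volume Ω ≠ ⊤ := D.bd.measure_lt_top.ne
  have main : ∀ ε, 0 < ε → ∫ x in Ω, ∫ t in Ioc 0 T, N x t ≤ 
      ε * ((M + κ * T) / κ * volume.real Ω) := by
    intro ε hε
    set J : E2 → ℝ → ℝ := fun x t =>
      gS ε (z x t) * ellOp k φ x + φ x * hS ε (z x t) * ellOp k (fun y => z y t) x with hJ
    set P : Fin 2 → E2 × ℝ → ℝ := fun i p => - (gS ε (z p.1 p.2) * pd i (pd i φ) p.1 +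
      φ p.1 * hS ε (z p.1 p.2) * Dx i (Dx i z) p.1 p.2) with hP
    set Q : Fin 2 → E2 × ℝ → ℝ := fun i p => - (gS ε (z p.1 p.2) * pd i φ p.1 +
      φ p.1 * hS ε (z p.1 p.2) * Dx i z p.1 p.2) with hQ
    have cz : Continuous (fun p : E2 × ℝ => z p.1 p.2) := hz.cont
    have c1 : Continuous (fun p : E2 × ℝ => gS ε (z p.1 p.2)) := (gS_contDiff ε).continuous.comp cz
    have c2 : Continuous (fun p : E2 × ℝ => φ p.1 * hS ε (z p.1 p.2)) :=
      (hφ.continuous.comp continuous_fst).mul ((hS_contDiff ε).continuous.comp cz)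
    have cφ1 : ∀ i, ContDiff ℝ ∞ (pd i φ) := fun i => contDiff_pd hφ (by simp) i
    have cφ2 : ∀ i, ContDiff ℝ ∞ (pd i (pd i φ)) := fun i => contDiff_pd (cφ1 i) (by simp) i
    have cP : ∀ i, Continuous (P i) := fun i => ((c1.mul
      ((cφ2 i).continuous.comp continuous_fst)).add (c2.mul ((hz.Dx i).Dx i).cont)).neg
    have cQ : ∀ i, Continuous (Q i) := fun i => ((c1.mul
      ((cφ1 i).continuous.comp continuous_fst)).add (c2.mul (hz.Dx i).cont)).neg
    have hJe : ∀ x ∈ Ω, ∀ t, J x t = ∑ i, (P i (x, t) * k x + Q i (x, t) * pd i k x) := by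
      intro x hx t
      simp only [hJ, hP, hQ]
      rw [ellOp_slice (D.diff hx) hz, ellOp_eq (D.diff hx) (hφ.of_le two_le)]
      simp only [Fin.sum_univ_two]
      ring
    have hJi : Integrable (Function.uncurry J)
        ((volume.restrict Ω).prod (volume.restrict (Ioc 0 T))) := by
      have h1 : Integrable (fun p : E2 × ℝ => ∑ i, (P i p * k p.1 + Q i p * pd i k p.1))
          ((volume.restrict Ω).prod (volume.restrict (Ioc 0 T))) := by
        refine integrable_finsetSum _ fun i _ => Integrable.add ?_ ?_
        · refine int2 D.op D.bd T (cP i) (k_cont D) (C := k₂) fun x hx => ?_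
          have := D.hkbd x (subset_closure hx)
          rw [abs_of_nonneg (by linarith [D.hk₁])]; exact this.2
        · exact int2 D.op D.bd T (cQ i) (pdk_cont D i) (C := K) fun x hx => hK x hx i
      refine h1.congr ?_
      rw [Measure.prod_restrict]
      filter_upwards [ae_restrict_mem (D.op.measurableSet.prod measurableSet_Ioc)] with p hp
      exact (hJe p.1 hp.1 p.2).symm
    have hJneg : ∫ x in Ω, ∫ t in Ioc 0 T, J x t ≤ 0 := by
      rw [integral_integral_swap hJi]
      refine setIntegral_nonpos measurableSet_Ioc fun t ht => ?_
      exact space_ineq D hφ (fun x => (hφM x).1) hφν (hz.slice_x t)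
        (fun x hx ν hν => hs.robin x hx ν hν.1 hν.2 t ht.1 ht.2) hε
    have hpt : ∀ x ∈ Ω, κ * (∫ t in Ioc 0 T, N x t) - ε * (M + κ * T) ≤ ∫ t in Ioc 0 T, J x t := by
      intro x hx
      rw [← intervalIntegral.integral_of_le hT.le, ← intervalIntegral.integral_of_le hT.le]
      have hJc : Continuous (J x) := by
        have : J x = fun t => ∑ i, (P i (x, t) * k x + Q i (x, t) * pd i k x) := by
          ext t; exact hJe x hx t
        rw [this]
        refine continuous_finsetSum _ fun i _ => ?_
        have hc : Continuous (fun t : ℝ => (x, t)) := by fun_prop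
        exact (((cP i).comp hc).mul continuous_const).add (((cQ i).comp hc).mul continuous_const)
      set dm := max (- d x) 0 with hdm
      have hdm0 : 0 ≤ dm := le_max_right _ _
      have hNx : Continuous (N x) := (hz.slice_t x).continuous.neg.max continuous_const
      set H : ℝ → ℝ := fun t => φ x * (gS ε (z x t) - dm * u x t) with hH
      set H' : ℝ → ℝ := fun t => φ x * (- hS ε (z x t) * Dt z x t - dm * Dt u x t) with hH'
      have hHd : ∀ t, HasDerivAt H (H' t) t := fun t =>
        (((gS_deriv ε (z x t)).comp t (hz.hasDerivAt x t)).sub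
          ((hu.hasDerivAt x t).const_mul dm)).const_mul (φ x)
      have hH'c : Continuous H' := by
        have e1 := (hz.slice_t x).continuous
        have e2 := (hz.Dt.slice_t x).continuous
        have e3 := (hu.Dt.slice_t x).continuous
        have e4 := (hS_contDiff ε).continuous.comp e1
        exact continuous_const.mul ((e4.neg.mul e2).sub (continuous_const.mul e3))
      have hint : ∫ t in (0:ℝ)..T, H' t = H T - H 0 :=
        intervalIntegral.integral_eq_sub_of_hasDerivAt (fun t _ => hHd t)
          (hH'c.intervalIntegrable _ _)
      have hle : ∫ t in (0:ℝ)..T, (H' t + κ * (N x t - ε)) ≤ ∫ t in (0:ℝ)..T, J x t := by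
        have hcl : Continuous (fun t => H' t + κ * (N x t - ε)) :=
          hH'c.add (continuous_const.mul (hNx.sub continuous_const))
        refine intervalIntegral.integral_mono_on_of_le_Ioo hT.le
          (hcl.intervalIntegrable _ _) (hJc.intervalIntegrable _ _) fun t ht => ?_
        have pde := hs.pde x hx t ht.1 ht.2.le
        have hv := hut x hx t ht.1.le ht.2.le
        have g1 := gS_le hε (z x t)
        have g2 := gS_ge hε (z x t)
        have g0 := gS_nonneg hε (z x t)
        have h0 := hS_nonneg ε (z x t)
        have h1 := hS_le_one ε (z x t)
        have φ0 := (hφM x).1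
        have qx := hq x hx
        have kx := hκφ x hx
        have a1 : κ * (N x t - ε) ≤ (q x * φ x + ellOp k φ x) * gS ε (z x t) :=
          (mul_le_mul_of_nonneg_left g2 hκ.le).trans (mul_le_mul_of_nonneg_right kx g0)
        have a2 : q x * φ x * gS ε (z x t) ≤ q x * φ x * (- z x t * hS ε (z x t)) :=
          mul_le_mul_of_nonneg_left g1 (mul_nonneg qx φ0)
        have a3 : - (dm * Dt u x t) ≤ hS ε (z x t) * (d x * Dt u x t) := by
          have b1 : - dm ≤ hS ε (z x t) * d x := by
            have : - d x ≤ dm := le_max_left _ _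
            nlinarith
          have := mul_le_mul_of_nonneg_right b1 hv
          linarith
        have a4 := mul_le_mul_of_nonneg_left a3 φ0
        have e : ellOp k (fun y => z y t) x = d x * Dt u x t - Dt z x t - q x * z x t := by
          have : deriv (z x) t = Dt z x t := rfl
          rw [this] at pde; linarith
        simp only [hJ, hH', e]
        linarith
      have hsplit : ∫ t in (0:ℝ)..T, (H' t + κ * (N x t - ε)) =
          H T - H 0 + κ * ((∫ t in (0:ℝ)..T, N x t) - ε * T) := by
        have cc : Continuous (fun t => κ * (N x t - ε)) :=
          continuous_const.mul (hNx.sub continuous_const)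
        rw [intervalIntegral.integral_add (hH'c.intervalIntegrable _ _)
          (cc.intervalIntegrable _ _), hint,
          intervalIntegral.integral_const_mul, intervalIntegral.integral_sub
          (hNx.intervalIntegrable _ _) (continuous_const.intervalIntegrable _ _)]
        simp [mul_comm]
      have hH0 : H 0 = 0 := by
        simp only [hH]; rw [hs.ic x hx, hu0 x hx, gS_zero hε le_rfl]; ring
      have hHT : - (ε * M) ≤ H T := by
        have b1 : dm * u x T ≤ max (- z x T) 0 := by
          rw [hdm, max_mul_of_nonneg _ _ (huT x hx).le, zero_mul]
          exact max_le_max (by linarith [hzT x hx]) le_rfl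
        have b2 : - ε ≤ gS ε (z x T) - dm * u x T := by linarith [gS_ge hε (z x T)]
        have b3 := mul_le_mul_of_nonneg_left b2 (hφM x).1
        have b4 : φ x * ε ≤ M * ε := mul_le_mul_of_nonneg_right (hφM x).2 hε.le
        simp only [hH]; linarith
      rw [hsplit, hH0] at hle
      linarith
    have hI1 : IntegrableOn (fun x => ∫ t in Ioc 0 T, N x t) Ω := hNi.integral_prod_left
    have hI2 : IntegrableOn (fun x => ∫ t in Ioc 0 T, J x t) Ω := hJi.integral_prod_left
    have hcst : IntegrableOn (fun _ : E2 => ε * (M + κ * T)) Ω := integrableOn_const hfinΩ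
    have h1 := setIntegral_mono_on ((hI1.const_mul κ).sub hcst) hI2 D.op.measurableSet hpt
    have h2 : ∫ x in Ω, (κ * (∫ t in Ioc 0 T, N x t) - ε * (M + κ * T)) =
        κ * (∫ x in Ω, ∫ t in Ioc 0 T, N x t) - volume.real Ω * (ε * (M + κ * T)) := by
      rw [integral_sub (hI1.const_mul κ) hcst, integral_const_mul, setIntegral_const, smul_eq_mul]
    have h3 : κ * (∫ x in Ω, ∫ t in Ioc 0 T, N x t) ≤ volume.real Ω * (ε * (M + κ * T)) := by
      have := h1.trans hJneg
      have e := h2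
      simp only [Pi.sub_apply] at this
      linarith
    have h4 : ε * ((M + κ * T) / κ * volume.real Ω) = volume.real Ω * (ε * (M + κ * T)) / κ := by
      ring
    rw [h4, le_div_iff₀ hκ]; linarith
  have hle0 : ∫ x in Ω, ∫ t in Ioc 0 T, N x t ≤ 0 := by
    refine le_of_forall_pos_le_add fun δ hδ => ?_
    set B := (M + κ * T) / κ * volume.real Ω with hB
    have h := main (δ / (|B| + 1)) (by positivity)
    refine h.trans ?_
    rw [zero_add, div_mul_eq_mul_div, div_le_iff₀ (by positivity)]
    exact mul_le_mul_of_nonneg_left (by linarith [le_abs_self B]) hδ.le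
  have hN0 : ∀ p : E2 × ℝ, 0 ≤ Function.uncurry N p := fun p => le_max_right _ _
  have hprod : ∫ p, Function.uncurry N p ∂((volume.restrict Ω).prod (volume.restrict (Ioc 0 T))) = 0 := by
    refine le_antisymm ?_ (integral_nonneg hN0)
    rw [integral_prod _ hNi]
    exact hle0
  rw [integral_eq_zero_iff_of_nonneg hN0 hNi, Measure.prod_restrict] at hprod
  have hae := ae_restrict_of_ae_restrict_of_subset
    (prod_mono (subset_refl Ω) (fun s (hs : s ∈ Ioo 0 T) => Ioo_subset_Ioc_self hs)) hprod
  have heq := Measure.eqOn_open_of_ae_eq hae (D.op.prod isOpen_Ioo) hNc.continuousOn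
    continuousOn_const
  intro x hx t h0 h1
  have := heq (show (x, t) ∈ Ω ×ˢ Ioo 0 T from ⟨hx, h0, h1⟩)
  have h2 : max (- z x t) 0 = 0 := this
  have := le_max_left (- z x t) 0
  linarith

lemma sol_neg {Ω T k μ k₁ k₂} (D : Dom Ω T k μ k₁ k₂) {q : E2 → ℝ} {g z : E2 → ℝ → ℝ}
    (hz : Sm z) (hs : IsDirectSolution Ω T k μ q g z) :
    IsDirectSolution Ω T k μ q (fun x t => - g x t) (fun x t => - z x t) := by
  refine ⟨fun x hx t h0 h1 => ?_, fun x hx => ?_, fun x hx ν hν hν2 t h0 h1 => ?_⟩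
  · have h := ellOp_sub (k := k) (v := fun _ => 0) (D.diff hx) contDiff_const
      ((hz.slice_x t).of_le two_le)
    have h' : ellOp k (fun _ => 0) x = 0 := ellOp_zero (Eventually.of_forall fun _ => rfl)
    simp only [zero_sub] at h
    rw [h, h']
    have e : deriv (fun t => - z x t) t = - deriv (z x) t := ((hz.hasDerivAt x t).neg).deriv
    rw [e]
    linear_combination - hs.pde x hx t h0 h1
  · rw [hs.ic x hx, neg_zero]
  · rw [fderiv_fun_neg]
    have := hs.robin x hx ν hν hν2 t h0 h1
    simp only [ContinuousLinearMap.neg_apply]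
    linear_combination - this

lemma at_T {T : ℝ} (hT : 0 < T) {h : ℝ → ℝ} (hc : Continuous h)
    (h0 : ∀ t, 0 < t → t < T → 0 ≤ h t) : 0 ≤ h T := by
  have h1 : Tendsto h (𝓝[<] T) (𝓝 (h T)) := hc.continuousAt.tendsto.mono_left nhdsWithin_le_nhds
  refine ge_of_tendsto h1 ?_
  filter_upwards [Ioo_mem_nhdsLT hT] with s hs using h0 s hs.1 hs.2

lemma coef_ball {Ω T k μ k₁ k₂} (D : Dom Ω T k μ k₁ k₂) {q : E2 → ℝ} {f U : E2 → ℝ → ℝ}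
    (hU : Sm U) (hf : Sm f) (hs : IsDirectSolution Ω T k μ q f U)
    (hU0 : ∀ x ∈ Ω, ∀ t, 0 ≤ t → t ≤ T → 0 ≤ U x t)
    (hfT : ∀ x ∈ Ω, 0 < f x T) {b : E2} (hb : b ∈ Ω) (hqb : 0 < q b) :
    ∃ ρ q0 : ℝ, 0 < ρ ∧ 0 < q0 ∧ ∀ x ∈ Ω, ‖x - b‖ < ρ → q0 ≤ q x := by
  have hT := D.hT
  have hUpos : 0 < U b T := by
    by_contra! hle
    have hz : U b T = 0 := le_antisymm hle (hU0 b hb T hT.le le_rfl)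
    have h1 : deriv (U b) T ≤ 0 := deriv_nonpos_of_left_min hT (hU.hasDerivAt b T)
      fun s h0 h1 => by rw [hz]; exact hU0 b hb s h0 h1
    have hmin : IsLocalMin (fun y => U y T) b := by
      filter_upwards [D.op.mem_nhds hb] with y hy
      rw [hz]; exact hU0 y hy T hT.le le_rfl
    have h2 := ellOp_nonpos (D.diff hb)
      (by linarith [(D.hkbd b (subset_closure hb)).1, D.hk₁]) ((hU.slice_x T).of_le two_le) hmin
    have h3 := hs.pde b hb T hT le_rfl
    rw [hz, mul_zero] at h3
    linarith [hfT b hb]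
  have hcU : ContinuousAt (fun x => U x T) b := (hU.slice_x T).continuous.continuousAt
  have hnb := D.op.mem_nhds hb
  have hcE : ContinuousAt (fun x => ellOp k (fun y => U y T) x) b := by
    have : ContinuousAt (fun x => - ∑ i : Fin 2,
        (k x * Dx i (Dx i U) x T + Dx i U x T * pd i k x)) b := by
      refine ContinuousAt.neg ?_
      refine tendsto_finsetSum _ fun i _ => ?_
      exact ((((k_cont D).continuousAt hnb).mul
        (((hU.Dx i).Dx i).slice_x T).continuous.continuousAt)).add
        (((hU.Dx i).slice_x T).continuous.continuousAt.mul ((pdk_cont D i).continuousAt hnb))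
    refine this.congr ?_
    filter_upwards [hnb] with x hx using (ellOp_slice (D.diff hx) hU T).symm
  have hcq : ContinuousAt q b := by
    have h : ContinuousAt (fun x => (f x T - Dt U x T - ellOp k (fun y => U y T) x) / U x T) b :=
      (((hf.slice_x T).continuous.continuousAt.sub
        (hU.Dt.slice_x T).continuous.continuousAt).sub hcE).div hcU hUpos.ne'
    refine h.congr ?_
    filter_upwards [hnb, hcU.eventually (lt_mem_nhds hUpos)] with x hx hx2
    have h3 : Dt U x T + ellOp k (fun y => U y T) x + q x * U x T = f x T :=
      hs.pde x hx T hT le_rfl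
    rw [div_eq_iff hx2.ne']; linarith
  have hev := hcq.eventually (lt_mem_nhds (half_lt_self hqb))
  obtain ⟨ρ, hρ, hB⟩ := Metric.eventually_nhds_iff.1 hev
  exact ⟨ρ, q b / 2, hρ, by linarith, fun x _ hx => (hB (by rwa [dist_eq_norm])).le⟩

theorem core {Ω T k μ k₁ k₂} (D : Dom Ω T k μ k₁ k₂) {c p q r ψ : E2 → ℝ}
    {f u U V X : E2 → ℝ → ℝ} (hf : Sm f) (hu : Sm u) (hU : Sm U) (hV : Sm V) (hX : Sm X)
    (hc : ∀ x ∈ Ω, 0 ≤ c x)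
    (su : IsDirectSolution Ω T k μ c f u) (sU : IsDirectSolution Ω T k μ q f U)
    (sV : IsDirectSolution Ω T k μ p f V) (sX : IsDirectSolution Ω T k μ r f X)
    (hf0 : ∀ x ∈ Ω, f x 0 = 0)
    (hft : ∀ x ∈ Ω, ∀ t : ℝ, 0 ≤ t → t ≤ T → 0 < deriv (f x) t)
    (hψdef : ∀ x, ψ x = u x T) (hψpos : ∀ x ∈ Ω, 0 < ψ x)
    (hp : ∀ x ∈ Ω, p x * ψ x = - deriv (U x) T - ellOp k ψ x + f x T)
    (hr : ∀ x ∈ Ω, r x * ψ x = - deriv (V x) T - ellOp k ψ x + f x T)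
    (hp0 : ∀ x ∈ Ω, 0 ≤ p x) (hpq : ∀ x ∈ Ω, p x - q x ≤ 0) :
    (∀ x ∈ Ω, r x - p x ≤ 0) ∧ (∀ x ∈ Ω, ∀ t : ℝ, 0 < t → t ≤ T → 0 ≤ X x t - V x t) := by
  have hT := D.hT
  have hq0 : ∀ x ∈ Ω, 0 ≤ q x := fun x hx => by linarith [hp0 x hx, hpq x hx]
  have hfpos : ∀ x ∈ Ω, ∀ t, 0 < t → t ≤ T → 0 < f x t := fun x hx t h0 h1 => by
    have := strictMonoOn_of_deriv_pos (convex_Icc 0 T) (hf.slice_t x).continuous.continuousOn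
      (fun s hs => by rw [interior_Icc] at hs; exact hft x hx s hs.1.le hs.2.le)
    have := this ⟨le_rfl, hT.le⟩ ⟨h0.le, h1⟩ h0
    rwa [hf0 x hx] at this
  have hfd : ∀ x ∈ Ω, ∀ t, 0 < t → t ≤ T → 0 ≤ Dt f x t := fun x hx t h0 h1 =>
    (hft x hx t h0.le h1).le
  have su' := sol_Dt D hu hf su hf0
  have sU' := sol_Dt D hU hf sU hf0
  have sV' := sol_Dt D hV hf sV hf0
  have nu := MP D hc hu.Dt su' hfd
  have nV := MP D hp0 hV.Dt sV' hfd
  have nU0 := MP D hq0 hU sU fun x hx t h0 h1 => (hfpos x hx t h0 h1).le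
  have nV0 := MP D hp0 hV sV fun x hx t h0 h1 => (hfpos x hx t h0 h1).le
  have hψe : ψ = fun y => u y T := funext hψdef
  have hcψ : ∀ x ∈ Ω, c x * ψ x = - Dt u x T - ellOp k ψ x + f x T := fun x hx => by
    have h : Dt u x T + ellOp k (fun y => u y T) x + c x * u x T = f x T :=
      su.pde x hx T hT le_rfl
    rw [hψe]; simp only; linarith
  have hp' : ∀ x ∈ Ω, p x * ψ x = - Dt U x T - ellOp k ψ x + f x T := hp
  have hr' : ∀ x ∈ Ω, r x * ψ x = - Dt V x T - ellOp k ψ x + f x T := hr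
  -- first conclusion
  have first : ∀ x ∈ Ω, r x - p x ≤ 0 := by
    intro x hx
    have := MP D hq0 (hV.Dt.sub hU.Dt) (sol_diff D hV.Dt hU.Dt sV' sU')
      (fun x hx t h0 h1 => mul_nonneg (by linarith [hpq x hx]) (nV x hx t h0.le h1))
      x hx T hT.le le_rfl
    have h1 : (r x - p x) * ψ x ≤ 0 := by linarith [hp' x hx, hr' x hx]
    exact nonpos_of_mul_nonpos_left h1 (hψpos x hx)
  have hr0 : ∀ x ∈ Ω, 0 ≤ r x := by
    by_cases hqz : ∀ x ∈ Ω, q x = 0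
    · intro x hx
      have hpz : ∀ x ∈ Ω, p x = 0 := fun x hx =>
        le_antisymm (by linarith [hpq x hx, hqz x hx]) (hp0 x hx)
      have := MP D hp0 (hU.Dt.sub hV.Dt) (sol_diff D hU.Dt hV.Dt sU' sV')
        (fun x hx t h0 h1 => by rw [hpz x hx, hqz x hx]; simp)
        x hx T hT.le le_rfl
      have h1 : 0 ≤ (r x - p x) * ψ x := by linarith [hp' x hx, hr' x hx]
      have := nonneg_of_mul_nonneg_left h1 (hψpos x hx)
      linarith [hp0 x hx]
    · push Not at hqz
      obtain ⟨b, hb, hqb⟩ := hqz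
      obtain ⟨ρ, q0, hρ, hq0', hball⟩ := coef_ball D hU hf sU nU0
        (fun x hx => hfpos x hx T hT le_rfl) hb (lt_of_le_of_ne (hq0 b hb) hqb.symm)
      have hpc : ∀ x ∈ Ω, c x ≤ p x := by
        intro x hx
        have hL := L1 D (d := fun x => q x - c x) hq0 hb hρ hq0' hball hu su.ic
          (fun x hx => by rw [← hψdef]; exact hψpos x hx) nu (hu.Dt.sub hU.Dt)
          (sol_diff D hu.Dt hU.Dt su' sU') (fun x hx => by
            rw [← hψdef]
            have : (p x - q x) * ψ x ≤ 0 :=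
              mul_nonpos_of_nonpos_of_nonneg (hpq x hx) (hψpos x hx).le
            linarith [hp' x hx, hcψ x hx])
        have h1 := at_T hT ((hu.Dt.sub hU.Dt).slice_t x).continuous (hL x hx)
        have h2 : 0 ≤ (p x - c x) * ψ x := by linarith [hp' x hx, hcψ x hx]
        have := nonneg_of_mul_nonneg_left h2 (hψpos x hx)
        linarith
      intro x hx
      have := MP D hp0 (hu.Dt.sub hV.Dt) (sol_diff D hu.Dt hV.Dt su' sV')
        (fun x hx t h0 h1 => mul_nonneg (by linarith [hpc x hx]) (nu x hx t h0.le h1))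
        x hx T hT.le le_rfl
      have h1 : 0 ≤ (r x - c x) * ψ x := by linarith [hr' x hx, hcψ x hx]
      have := nonneg_of_mul_nonneg_left h1 (hψpos x hx)
      linarith [hc x hx]
  refine ⟨first, fun x hx t h0 h1 => ?_⟩
  have := MP D hr0 (hV.sub hX).neg (sol_neg D (hV.sub hX) (sol_diff D hV hX sV sX))
    (fun x hx t h0 h1 => by
      have := mul_nonpos_of_nonpos_of_nonneg (first x hx) (nV0 x hx t h0.le h1)
      linarith) x hx t h0.le h1
  linarith

/-- induction step: if for some `k ≥ 1` we have `cᵏ ≥ 0`,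
`wᵏ = uᵏ - uᵏ⁻¹ ≥ 0` and `ξᵏ = cᵏ - cᵏ⁻¹ ≤ 0`, then `ξᵏ⁺¹ ≤ 0` and `wᵏ⁺¹ ≥ 0`. -/
theorem monotone_induction_step
    (Ω : Set E2) (hΩo : IsOpen Ω) (hΩb : Bornology.IsBounded Ω) (hΩconv : Convex ℝ Ω)
    (T : ℝ) (hT : 0 < T)
    (k μ : E2 → ℝ) (k₁ k₂ : ℝ) (hk₁ : 0 < k₁)
    (hkbd : ∀ x ∈ closure Ω, k₁ ≤ k x ∧ k x ≤ k₂)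
    (hkC1 : ContDiffOn ℝ 1 k (closure Ω))
    (hμ : ∀ x ∈ frontier Ω, 0 ≤ μ x)
    (f : E2 → ℝ → ℝ) (hf : ContDiff ℝ (⊤ : ℕ∞) (Function.uncurry f))
    (c : E2 → ℝ) (hc : ∀ x ∈ Ω, 0 ≤ c x)
    (u : E2 → ℝ → ℝ) (hureg : ContDiff ℝ (⊤ : ℕ∞) (Function.uncurry u))
    (hu : IsDirectSolution Ω T k μ c f u)
    (hf0 : ∀ x ∈ Ω, f x 0 = 0)
    (hft : ∀ x ∈ Ω, ∀ t : ℝ, 0 ≤ t → t ≤ T → 0 < deriv (f x) t)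
    (ψ : E2 → ℝ) (hψdef : ∀ x, ψ x = u x T) (hψpos : ∀ x ∈ Ω, 0 < ψ x)
    (cs : ℕ → E2 → ℝ) (us : ℕ → E2 → ℝ → ℝ)
    (hsol : ∀ n : ℕ, IsDirectSolution Ω T k μ (cs n) f (us n))
    (hregs : ∀ n : ℕ, ContDiff ℝ (⊤ : ℕ∞) (Function.uncurry (us n)))
    (hiter : ∀ n : ℕ, ∀ x ∈ Ω,
      cs (n + 1) x * ψ x = - deriv (us n x) T - ellOp k ψ x + f x T)
    (n : ℕ) (hn : 1 ≤ n)
    (hck : ∀ x ∈ Ω, 0 ≤ cs n x)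
    (hwk : ∀ x ∈ Ω, ∀ t : ℝ, 0 < t → t ≤ T → 0 ≤ us n x t - us (n - 1) x t)
    (hxik : ∀ x ∈ Ω, cs n x - cs (n - 1) x ≤ 0) :
    (∀ x ∈ Ω, cs (n + 1) x - cs n x ≤ 0) ∧
      (∀ x ∈ Ω, ∀ t : ℝ, 0 < t → t ≤ T → 0 ≤ us (n + 1) x t - us n x t) := by
  rcases Ω.eq_empty_or_nonempty with rfl | ne
  · exact ⟨fun x hx => absurd hx (Set.notMem_empty x), fun x hx => absurd hx (Set.notMem_empty x)⟩
  obtain ⟨m, rfl⟩ : ∃ m, n = m + 1 := ⟨n - 1, by omega⟩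
  have D : Dom Ω T k μ k₁ k₂ := ⟨hΩo, hΩb, hΩconv, ne, hT, hk₁, hkbd, hkC1, hμ⟩
  exact core D hf hureg (hregs m) (hregs (m + 1)) (hregs (m + 1 + 1)) hc hu (hsol m)
    (hsol (m + 1)) (hsol (m + 1 + 1)) hf0 hft hψdef hψpos (hiter m) (hiter (m + 1)) hck hxik

end
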